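/- Let f be a smooth compactly supported function on ℝ³ whose support is contained in the open upper half space U = {(x₁,x₂,x₃) ∈ ℝ³ : x₃ > 0}, and let F be its polar form. Then for all ρ ≥ 0, θ ∈ [0,2π], and φ ∈ [0,π/2], the double series 2 Σ_{l even} Σ_{|m|≤l} F_{lm}(ρ) Y_l^m(θ,φ), summed over even natural numbers l and integers m with |m| ≤ l, converges absolutely and equals F(ρ,θ,φ). In particular, the even-degree harmonic coefficients F_{lm} (l even, |m| ≤ l) determine F uniquely. -/

import Mathlib

noncomputable section
open Real MeasureTheory Set Filter

abbrev R3 := EuclideanSpace ℝ (Fin 3)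

/-- The unit vector with spherical angles `θ` (azimuth) and `φ` (colatitude). -/
def sphVec (θ φ : ℝ) : R3 :=
  (WithLp.equiv 2 (Fin 3 → ℝ)).symm ![sin φ * cos θ, sin φ * sin θ, cos φ]

/-- Rotation about the `x₃` axis by angle `α`. -/
def rotZ (α : ℝ) (x : R3) : R3 :=
  (WithLp.equiv 2 (Fin 3 → ℝ)).symm
    ![cos α * x 0 - sin α * x 1, sin α * x 0 + cos α * x 1, x 2]

/-- Rotation about the `x₂` axis by angle `β`. -/
def rotY (β : ℝ) (x : R3) : R3 :=
  (WithLp.equiv 2 (Fin 3 → ℝ)).symm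
    ![cos β * x 0 + sin β * x 2, x 1, -sin β * x 0 + cos β * x 2]

/-- `h = U(α)V(β)`. -/
def rotUV (α β : ℝ) (x : R3) : R3 := rotZ α (rotY β x)

/-- Legendre polynomial of degree `l`. -/
def legendreP (l : ℕ) (x : ℝ) : ℝ :=
  (1 / 2 ^ l) * ∑ k ∈ Finset.range (l + 1),
    (l.choose k : ℝ) ^ 2 * (x - 1) ^ (l - k) * (x + 1) ^ k

/-- Associated Legendre function for `0 ≤ m ≤ l`. -/
def assocP (l m : ℕ) (x : ℝ) : ℝ :=
  (-1 : ℝ) ^ m * (1 - x ^ 2) ^ ((m : ℝ) / 2) * iteratedDeriv m (legendreP l) x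

/-- Associated Legendre function for integer `m`, `|m| ≤ l`. -/
def assocPZ (l : ℕ) (m : ℤ) (x : ℝ) : ℝ :=
  if 0 ≤ m then assocP l m.toNat x
  else (-1 : ℝ) ^ m.natAbs *
    (((l - m.natAbs).factorial : ℝ) / ((l + m.natAbs).factorial : ℝ)) * assocP l m.natAbs x

/-- Spherical harmonic `Y_l^m(θ,φ)`. -/
def sphHarm (l : ℕ) (m : ℤ) (θ φ : ℝ) : ℂ :=
  Complex.ofReal ((-1 : ℝ) ^ m *
    Real.sqrt ((2 * (l : ℝ) + 1) * (((l : ℤ) - m).toNat.factorial : ℝ) /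
      (4 * π * (((l : ℤ) + m).toNat.factorial : ℝ))) *
    assocPZ l m (cos φ)) * Complex.exp (Complex.I * m * θ)

/-- Harmonic coefficient `F_{lm}(ρ)` of the polar form `F` of `f`. -/
def harmCoef (f : R3 → ℝ) (l : ℕ) (m : ℤ) (ρ : ℝ) : ℂ :=
  ∫ φ in (0:ℝ)..π, ∫ θ in (0:ℝ)..(2 * π),
    (f (ρ • sphVec θ φ) : ℂ) * (starRingEnd ℂ) (sphHarm l m θ φ) * (sin φ : ℂ)

/-- The symmetric curve `ρ(r,φ) = p(arcsin (r sin φ))`. -/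
def curveρ (p : ℝ → ℝ) (r φ : ℝ) : ℝ := p (arcsin (r * sin φ))

/-- The generalized spindle transform `𝒮_{w,p} f`. -/
def genSpindle (w : ℝ → ℝ → ℝ) (p : ℝ → ℝ) (f : R3 → ℝ) (r α β : ℝ) : ℝ :=
  ∫ θ in (0:ℝ)..(2 * π), ∫ φ in (0:ℝ)..π,
    w r φ * curveρ p r φ * sin φ *
      Real.sqrt ((curveρ p r φ) ^ 2 + (deriv (curveρ p r) φ) ^ 2) *
      f (curveρ p r φ • rotUV α β (sphVec θ φ))

/-- The `(l,m)` spherical harmonic coefficient of `𝒮_{w,p} f` in `(α,β)`. -/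
def genSpindleCoef (w : ℝ → ℝ → ℝ) (p : ℝ → ℝ) (f : R3 → ℝ) (l : ℕ) (m : ℤ) (r : ℝ) : ℂ :=
  ∫ β in (0:ℝ)..π, ∫ α in (0:ℝ)..(2 * π),
    (genSpindle w p f r α β : ℂ) * (starRingEnd ℂ) (sphHarm l m α β) * (sin β : ℂ)

section Polynomials

open Polynomial

/-- The Legendre polynomial of degree `l` as an element of `ℝ[X]`. -/
def legendrePoly (l : ℕ) : ℝ[X] :=
  C (1 / 2 ^ l) * ∑ p ∈ Finset.HasAntidiagonal.antidiagonal l,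
    C ((l.choose p.2 : ℝ) ^ 2) * ((X - 1) ^ p.1 * (X + 1) ^ p.2)

theorem eval_legendrePoly (l : ℕ) (x : ℝ) : (legendrePoly l).eval x = legendreP l x := by
  rw [legendrePoly, legendreP, Finset.Nat.antidiagonal_eq_map', Finset.sum_map, eval_mul, eval_C,
    eval_finsetSum]
  congr 1
  apply Finset.sum_congr rfl
  intro k hk
  simp only [eval_mul, eval_C, eval_pow, eval_sub, eval_add, eval_X, eval_one, mul_assoc]
  rfl

theorem iteratedDeriv_legendreP (l m : ℕ) (x : ℝ) :
    iteratedDeriv m (legendreP l) x = (derivative^[m] (legendrePoly l)).eval x := by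
  induction m generalizing x with
  | zero => simp [eval_legendrePoly]
  | succ m ih =>
    rw [iteratedDeriv_succ, Function.iterate_succ_apply', ← Polynomial.deriv]
    congr 1
    exact funext ih

theorem sum_antidiagonal_choose_shift_left {R : Type*} [CommRing R] (l : ℕ) (u v : R) :
    ∑ p ∈ Finset.HasAntidiagonal.antidiagonal l,
        ((l.choose p.2 : R) ^ 2 * (p.1 : R) ^ 2) * (u ^ (p.1 - 1) * v ^ (p.2 + 1)) =
      ∑ p ∈ Finset.HasAntidiagonal.antidiagonal l,
        ((l.choose p.2 : R) ^ 2 * (p.2 : R) ^ 2) * (u ^ p.1 * v ^ p.2) := by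
  cases l with
  | zero => simp
  | succ n =>
    rw [Finset.Nat.sum_antidiagonal_succ, Finset.Nat.sum_antidiagonal_succ']
    simp only [Nat.cast_zero, ne_eq, OfNat.ofNat_ne_zero, not_false_eq_true, zero_pow, mul_zero,
      zero_mul, zero_add, Nat.add_sub_cancel]
    apply Finset.sum_congr rfl
    rintro ⟨a, b⟩ hab
    have hab : a + b = n := by simpa using hab
    have h := Nat.choose_succ_right_eq (n + 1) b
    rw [show n + 1 - b = a + 1 by omega] at h
    have h' : ((n + 1).choose (b + 1) : R) * ((b + 1 : ℕ) : R) =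
      ((n + 1).choose b : R) * ((a + 1 : ℕ) : R) := by exact_mod_cast congrArg (Nat.cast (R := R)) h
    simp only [← mul_pow, h']

theorem sum_antidiagonal_choose_shift_right {R : Type*} [CommRing R] (l : ℕ) (u v : R) :
    ∑ p ∈ Finset.HasAntidiagonal.antidiagonal l,
        ((l.choose p.2 : R) ^ 2 * (p.2 : R) ^ 2) * (u ^ (p.1 + 1) * v ^ (p.2 - 1)) =
      ∑ p ∈ Finset.HasAntidiagonal.antidiagonal l,
        ((l.choose p.2 : R) ^ 2 * (p.1 : R) ^ 2) * (u ^ p.1 * v ^ p.2) := by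
  rw [← Finset.Nat.sum_antidiagonal_swap]
  conv_rhs => rw [← Finset.Nat.sum_antidiagonal_swap]
  have := sum_antidiagonal_choose_shift_left l v u
  convert this using 1 <;> apply Finset.sum_congr rfl <;> rintro ⟨a, b⟩ hab <;>
    have hab : a + b = l := by simpa using hab
  all_goals
    simp only [Prod.fst_swap, Prod.snd_swap]
    rw [Nat.choose_symm_of_eq_add hab.symm]
    ring

/-- The Legendre differential equation in self-adjoint form. -/
theorem legendrePoly_ode (l : ℕ) :
    derivative ((X ^ 2 - 1) * derivative (legendrePoly l)) =
      C ((l : ℝ) * (l + 1)) * legendrePoly l := by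
  have key : ∀ a b : ℕ, derivative ((X ^ 2 - 1) * derivative ((X - 1 : ℝ[X]) ^ a * (X + 1) ^ b)) =
      C ((a : ℝ) ^ 2) * ((X - 1) ^ (a - 1) * (X + 1) ^ (b + 1)) +
      C (2 * (a : ℝ) * b + a + b) * ((X - 1) ^ a * (X + 1) ^ b) +
      C ((b : ℝ) ^ 2) * ((X - 1) ^ (a + 1) * (X + 1) ^ (b - 1)) := by
    intro a b
    have h1 : (X ^ 2 - 1) * derivative ((X - 1 : ℝ[X]) ^ a * (X + 1) ^ b) =
        C (a : ℝ) * ((X - 1) ^ a * (X + 1) ^ (b + 1)) +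
          C (b : ℝ) * ((X - 1) ^ (a + 1) * (X + 1) ^ b) := by
      rcases a with _ | a <;> rcases b with _ | b <;>
        simp [derivative_mul, derivative_pow] <;> ring
    rw [h1]
    have hC : (C 2 : ℝ[X]) = 2 := map_ofNat C 2
    simp [derivative_mul, derivative_pow, hC]
    ring
  have h := sum_antidiagonal_choose_shift_left l (X - 1 : ℝ[X]) (X + 1)
  have h' := sum_antidiagonal_choose_shift_right l (X - 1 : ℝ[X]) (X + 1)
  have expand : derivative ((X ^ 2 - 1) * derivative (∑ p ∈ Finset.HasAntidiagonal.antidiagonal l,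
      C ((l.choose p.2 : ℝ) ^ 2) * ((X - 1) ^ p.1 * (X + 1) ^ p.2))) =
      C ((l : ℝ) * (l + 1)) * ∑ p ∈ Finset.HasAntidiagonal.antidiagonal l,
      C ((l.choose p.2 : ℝ) ^ 2) * ((X - 1) ^ p.1 * (X + 1) ^ p.2) := by
    simp only [derivative_sum, Finset.mul_sum, derivative_C_mul, mul_left_comm (X ^ 2 - 1 : ℝ[X]) (C _),
      key]
    simp only [mul_add, Finset.sum_add_distrib]
    simp only [← mul_assoc, C_pow, map_natCast] at h h' ⊢
    rw [h, h', ← Finset.sum_add_distrib, ← Finset.sum_add_distrib]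
    apply Finset.sum_congr rfl
    rintro ⟨a, b⟩ hab
    have hab : a + b = l := by simpa using hab
    subst hab
    have hC : (C 2 : ℝ[X]) = 2 := map_ofNat C 2
    simp [hC]
    ring
  rw [legendrePoly, derivative_C_mul, mul_left_comm, derivative_C_mul, expand]
  ring

/-- The differential equation satisfied by the derivatives of the Legendre polynomials. -/
theorem legendrePoly_iterate_ode (l m : ℕ) :
    (1 - X ^ 2) * derivative^[m + 2] (legendrePoly l) =
      C (2 * ((m : ℝ) + 1)) * (X * derivative^[m + 1] (legendrePoly l)) -
        C ((l : ℝ) * (l + 1) - m * (m + 1)) * derivative^[m] (legendrePoly l) := by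
  have hC : (C 2 : ℝ[X]) = 2 := map_ofNat C 2
  induction m with
  | zero =>
    have := legendrePoly_ode l
    simp [derivative_mul, hC] at this ⊢
    linear_combination -this
  | succ m ih =>
    have := congrArg derivative ih
    simp only [derivative_mul, derivative_sub, derivative_C, derivative_X, derivative_one,
      derivative_X_pow, ← Function.iterate_succ_apply' (derivative (R := ℝ)),
      Nat.succ_eq_add_one, Nat.add_assoc, Nat.reduceAdd] at this
    rw [show m + 1 + 2 = m + 3 from rfl, show m + 1 + 1 = m + 2 from rfl]
    simp [hC] at this ⊢
    linear_combination this

theorem eval_one_legendrePoly (l : ℕ) : (legendrePoly l).eval 1 = 1 := by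
  rw [eval_legendrePoly, legendreP, Finset.sum_range_succ, Finset.sum_eq_zero]
  · norm_num
  · intro k hk
    have hk : l - k ≠ 0 := by have := Finset.mem_range.mp hk; omega
    simp [hk]

theorem degree_legendrePoly (l : ℕ) : (legendrePoly l).degree = l := by
  have hmonic : ∀ p : ℕ × ℕ, ((X - 1 : ℝ[X]) ^ p.1 * (X + 1) ^ p.2).Monic := fun p =>
    ((monic_X_sub_C (1 : ℝ)).pow p.1).mul ((monic_X_add_C (1 : ℝ)).pow p.2)
  have hdeg : ∀ p ∈ Finset.HasAntidiagonal.antidiagonal l,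
      ((X - 1 : ℝ[X]) ^ p.1 * (X + 1) ^ p.2).natDegree = l := by
    rintro ⟨a, b⟩ hab
    have hab : a + b = l := by simpa using hab
    have h1 := ((monic_X_sub_C (1 : ℝ)).pow a).natDegree_mul ((monic_X_add_C (1 : ℝ)).pow b)
    rw [(monic_X_sub_C (1 : ℝ)).natDegree_pow, (monic_X_add_C (1 : ℝ)).natDegree_pow,
      natDegree_X_sub_C, natDegree_X_add_C] at h1
    simpa [hab] using h1
  have hcoeff : (legendrePoly l).coeff l ≠ 0 := by
    have : (legendrePoly l).coeff l =
        (1 / 2 ^ l) * ∑ p ∈ Finset.HasAntidiagonal.antidiagonal l, (l.choose p.2 : ℝ) ^ 2 := by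
      rw [legendrePoly, coeff_C_mul, finsetSum_coeff]
      congr 1
      apply Finset.sum_congr rfl
      intro p hp
      have := (hmonic p).coeff_natDegree
      rw [hdeg p hp] at this
      rw [coeff_C_mul, this, mul_one]
    rw [this]
    have hpos : 0 < ∑ p ∈ Finset.HasAntidiagonal.antidiagonal l, (l.choose p.2 : ℝ) ^ 2 := by
      apply Finset.sum_pos' (fun _ _ => sq_nonneg _)
      exact ⟨(l, 0), by simp, by simp⟩
    positivity
  refine le_antisymm ?_ (le_degree_of_ne_zero hcoeff)
  rw [← natDegree_le_iff_degree_le]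
  refine (natDegree_C_mul_le _ _).trans (natDegree_sum_le_of_forall_le _ _ fun p hp => ?_)
  exact (natDegree_C_mul_le _ _).trans (hdeg p hp).le

theorem iterate_derivative_legendrePoly_eq_zero {l m : ℕ} (h : l < m) :
    derivative^[m] (legendrePoly l) = 0 :=
  iterate_derivative_eq_zero (by rwa [natDegree_eq_of_degree_eq_some (degree_legendrePoly l)])

theorem degree_iterate_derivative_legendrePoly (m i : ℕ) :
    (derivative^[m] (legendrePoly (m + i))).degree = i := by
  suffices h : ∀ (m : ℕ) (p : ℝ[X]), p.degree = (m + i : ℕ) → (derivative^[m] p).degree = i from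
    h m _ (degree_legendrePoly _)
  intro m
  induction m with
  | zero => intro p hp; simpa using hp
  | succ m ih =>
    intro p hp
    have hn := natDegree_eq_of_degree_eq_some hp
    refine ih _ ?_
    rw [degree_derivative (by omega), hn]
    congr 1
    omega

/-- The derivatives of order `m` of the Legendre polynomials span all polynomials. -/
theorem span_iterate_derivative_legendrePoly (m : ℕ) :
    Submodule.span ℝ (Set.range fun i => derivative^[m] (legendrePoly (m + i))) = ⊤ :=
  Polynomial.Sequence.span
    ⟨fun i => derivative^[m] (legendrePoly (m + i)), degree_iterate_derivative_legendrePoly m⟩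
    fun i => IsUnit.mk0 _ (by
      rw [leadingCoeff_ne_zero]
      exact Polynomial.Sequence.ne_zero _ i)

/-- The ratio `(l - m)! / (l + m)!` in the normalization of the associated Legendre functions. -/
def legendreWeight (l m : ℕ) : ℝ := ((l - m).factorial : ℝ) / ((l + m).factorial : ℝ)

theorem legendreWeight_pos (l m : ℕ) : 0 < legendreWeight l m := by
  unfold legendreWeight; positivity

theorem legendreWeight_zero (l : ℕ) : legendreWeight l 0 = 1 := by
  simp [legendreWeight, Nat.factorial_ne_zero]

theorem legendreWeight_succ {l m : ℕ} (h : m < l) :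
    legendreWeight l (m + 1) * ((l : ℝ) * (l + 1) - m * (m + 1)) = legendreWeight l m := by
  obtain ⟨k, rfl⟩ := Nat.exists_eq_add_of_lt h
  unfold legendreWeight
  rw [show m + k + 1 - (m + 1) = k by omega, show m + k + 1 - m = k + 1 by omega,
    show m + k + 1 + (m + 1) = (m + k + 1 + m) + 1 by omega, Nat.factorial_succ k,
    Nat.factorial_succ (m + k + 1 + m)]
  have := Nat.factorial_pos (m + k + 1 + m)
  push_cast
  field_simp
  ring

theorem derivative_assocLegendre_mul (l k m : ℕ) :
    derivative ((1 - X ^ 2) ^ (m + 1) * derivative^[m + 1] (legendrePoly l) *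
        derivative^[m] (legendrePoly k)) =
      (1 - X ^ 2) ^ (m + 1) * derivative^[m + 1] (legendrePoly l) *
        derivative^[m + 1] (legendrePoly k) -
      C ((l : ℝ) * (l + 1) - m * (m + 1)) * ((1 - X ^ 2) ^ m * derivative^[m] (legendrePoly l) *
        derivative^[m] (legendrePoly k)) := by
  have hC : (C 2 : ℝ[X]) = 2 := map_ofNat C 2
  have h := legendrePoly_iterate_ode l m
  simp only [derivative_mul, ← Function.iterate_succ_apply' (derivative (R := ℝ)), derivative_pow,
    Nat.succ_eq_add_one, Nat.add_assoc, Nat.reduceAdd, derivative_sub, derivative_one,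
    derivative_X, Nat.add_sub_cancel] at h ⊢
  simp [hC] at h ⊢
  simp only [← Function.iterate_succ_apply (derivative (R := ℝ)), Nat.succ_eq_add_one] at h ⊢
  linear_combination (1 - X ^ 2) ^ m * (derivative^[m] (legendrePoly k)) * h

theorem derivative_assocLegendre_sq (l m : ℕ) :
    derivative ((1 - X ^ 2) ^ (m + 1) * derivative^[m + 1] (legendrePoly l) ^ 2) =
      (1 - X ^ 2) ^ (m + 1) * (derivative^[m + 1] (legendrePoly l) *
        derivative^[m + 2] (legendrePoly l)) -
      C ((l : ℝ) * (l + 1) - m * (m + 1)) * ((1 - X ^ 2) ^ m * (derivative^[m] (legendrePoly l) *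
        derivative^[m + 1] (legendrePoly l))) := by
  have hC : (C 2 : ℝ[X]) = 2 := map_ofNat C 2
  have h := legendrePoly_iterate_ode l m
  simp only [derivative_mul, ← Function.iterate_succ_apply' (derivative (R := ℝ)), derivative_pow,
    Nat.succ_eq_add_one, Nat.add_assoc, Nat.reduceAdd, derivative_sub, derivative_one,
    derivative_X, Nat.add_sub_cancel] at h ⊢
  simp [hC] at h ⊢
  simp only [← Function.iterate_succ_apply (derivative (R := ℝ)), Nat.succ_eq_add_one] at h ⊢
  linear_combination (1 - X ^ 2) ^ m * (derivative^[m + 1] (legendrePoly l)) * h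

/-- The addition theorem on the diagonal, in polynomial form. -/
theorem sum_assocLegendre_sq (l : ℕ) :
    legendrePoly l ^ 2 + 2 * ∑ m ∈ Finset.range l, C (legendreWeight l (m + 1)) *
      ((1 - X ^ 2) ^ (m + 1) * derivative^[m + 1] (legendrePoly l) ^ 2) = 1 := by
  set S := legendrePoly l ^ 2 + 2 * ∑ m ∈ Finset.range l, C (legendreWeight l (m + 1)) *
      ((1 - X ^ 2) ^ (m + 1) * derivative^[m + 1] (legendrePoly l) ^ 2) with hS
  have hder : derivative S = 0 := by
    have hsum : derivative (∑ m ∈ Finset.range l, C (legendreWeight l (m + 1)) *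
        ((1 - X ^ 2) ^ (m + 1) * derivative^[m + 1] (legendrePoly l) ^ 2)) =
        ∑ m ∈ Finset.range l,
          (C (legendreWeight l (m + 1)) * ((1 - X ^ 2) ^ (m + 1) *
            (derivative^[m + 1] (legendrePoly l) * derivative^[m + 1 + 1] (legendrePoly l))) -
          C (legendreWeight l m) * ((1 - X ^ 2) ^ m *
            (derivative^[m] (legendrePoly l) * derivative^[m + 1] (legendrePoly l)))) := by
      rw [derivative_sum]
      refine Finset.sum_congr rfl fun m hm => ?_
      rw [derivative_C_mul, derivative_assocLegendre_sq,
        ← legendreWeight_succ (Finset.mem_range.mp hm), C_mul]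
      ring
    rw [Finset.sum_range_sub (fun m => C (legendreWeight l m) * ((1 - X ^ 2) ^ m *
            (derivative^[m] (legendrePoly l) * derivative^[m + 1] (legendrePoly l)))),
      iterate_derivative_legendrePoly_eq_zero (Nat.lt_succ_self l), legendreWeight_zero] at hsum
    have h2 : derivative (2 : ℝ[X]) = 0 := derivative_ofNat 2
    rw [hS, derivative_add, derivative_mul, hsum, h2, sq, derivative_mul]
    simp
    ring
  have hconst := eq_C_of_natDegree_eq_zero (derivative_eq_zero.mp hder)
  have h1 : S.eval 1 = 1 := by
    simp [hS, eval_finsetSum, eval_one_legendrePoly]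
  rw [hconst, eval_C] at h1
  rw [hconst, h1, C_1]

theorem legendreWeight_mul_eval_sq_le (l m : ℕ) {x : ℝ} (hx : x ^ 2 ≤ 1) :
    legendreWeight l m * ((1 - x ^ 2) ^ m * (derivative^[m] (legendrePoly l)).eval x ^ 2) ≤ 1 := by
  have h := congrArg (eval x) (sum_assocLegendre_sq l)
  have hterm : ∀ m, 0 ≤ legendreWeight l m *
      ((1 - x ^ 2) ^ m * (derivative^[m] (legendrePoly l)).eval x ^ 2) := fun m =>
    mul_nonneg (legendreWeight_pos l m).le
      (mul_nonneg (pow_nonneg (by linarith) _) (sq_nonneg _))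
  simp only [eval_add, eval_pow, eval_mul, eval_ofNat, eval_finsetSum, eval_C, eval_sub, eval_one,
    eval_X] at h
  rcases m with _ | m
  · have := Finset.sum_nonneg fun i (_ : i ∈ Finset.range l) => hterm (i + 1)
    rw [legendreWeight_zero, one_mul, pow_zero, one_mul, Function.iterate_zero, id]
    linarith
  · by_cases hm : m < l
    · have := Finset.single_le_sum (fun i _ => hterm (i + 1)) (Finset.mem_range.mpr hm)
      nlinarith [sq_nonneg (eval x (legendrePoly l)), hterm (m + 1)]
    · rw [iterate_derivative_legendrePoly_eq_zero (by omega)]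
      simp

/-- The inner product of two associated Legendre functions of order `m`. -/
def assocLegendreInner (m l k : ℕ) : ℝ :=
  ∫ x in (-1 : ℝ)..1, ((1 - X ^ 2) ^ m * derivative^[m] (legendrePoly l) *
    derivative^[m] (legendrePoly k)).eval x

theorem assocLegendreInner_succ (m l k : ℕ) : assocLegendreInner (m + 1) l k =
    ((l : ℝ) * (l + 1) - m * (m + 1)) * assocLegendreInner m l k := by
  have h := intervalIntegral.integral_eq_sub_of_hasDerivAt (a := -1) (b := 1)
    (fun x _ => ((1 - X ^ 2) ^ (m + 1) * derivative^[m + 1] (legendrePoly l) *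
        derivative^[m] (legendrePoly k)).hasDerivAt x)
    ((Polynomial.continuous _).intervalIntegrable _ _)
  rw [derivative_assocLegendre_mul] at h
  simp only [eval_sub, eval_C_mul] at h
  rw [intervalIntegral.integral_sub ((Polynomial.continuous _).intervalIntegrable _ _)
    (((Polynomial.continuous _).const_mul _).intervalIntegrable _ _),
    intervalIntegral.integral_const_mul] at h
  simp only [eval_mul, eval_pow, eval_sub, eval_one, eval_X, one_pow, even_two, Even.neg_pow,
    sub_self, ne_eq, Nat.add_eq_zero_iff, one_ne_zero, and_false, not_false_eq_true, zero_pow,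
    zero_mul] at h
  unfold assocLegendreInner
  simp only [eval_mul, eval_pow, eval_sub, eval_one, eval_X]
  linarith

theorem assocLegendreInner_comm (m l k : ℕ) :
    assocLegendreInner m l k = assocLegendreInner m k l := by
  unfold assocLegendreInner
  congr 1 with x
  rw [mul_right_comm]

theorem assocLegendreInner_of_ne (m : ℕ) {l k : ℕ} (h : l ≠ k) : assocLegendreInner m l k = 0 := by
  induction m with
  | zero =>
    have h1 := assocLegendreInner_succ 0 l k
    rw [assocLegendreInner_comm, assocLegendreInner_succ, assocLegendreInner_comm 0 k l] at h1
    have h2 : ((k : ℝ) - l) * (k + l + 1) * assocLegendreInner 0 l k = 0 := by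
      push_cast at h1
      linarith
    have h3 : (k : ℝ) - l ≠ 0 := sub_ne_zero.mpr (by exact_mod_cast h.symm)
    have h4 : (k : ℝ) + l + 1 ≠ 0 := by positivity
    simpa [h3, h4] using h2
  | succ m ih => rw [assocLegendreInner_succ, ih, mul_zero]

theorem legendreWeight_mul_assocLegendreInner_self {l m : ℕ} (h : m ≤ l) :
    legendreWeight l m * assocLegendreInner m l l = 2 / (2 * l + 1) := by
  have step : ∀ m ≤ l, legendreWeight l m * assocLegendreInner m l l =
      assocLegendreInner 0 l l := by
    intro m hm
    induction m with
    | zero => rw [legendreWeight_zero, one_mul]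
    | succ m ih =>
      rw [assocLegendreInner_succ, ← mul_assoc, legendreWeight_succ hm, ih (by omega)]
  have hsum := congrArg (fun p => ∫ x in (-1 : ℝ)..1, p.eval x) (sum_assocLegendre_sq l)
  simp only [eval_add, eval_mul, eval_ofNat, eval_finsetSum, eval_C, eval_one] at hsum
  rw [intervalIntegral.integral_add
      ((Polynomial.continuous _).intervalIntegrable _ _)
      (by apply Continuous.intervalIntegrable; fun_prop),
    intervalIntegral.integral_const_mul, intervalIntegral.integral_finsetSum
      (fun i _ => by apply Continuous.intervalIntegrable; fun_prop)] at hsum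
  simp only [intervalIntegral.integral_const_mul] at hsum
  have hterm : ∀ i ∈ Finset.range l, legendreWeight l (i + 1) * (∫ x in (-1 : ℝ)..1,
      eval x ((1 - X ^ 2) ^ (i + 1)) * eval x (derivative^[i + 1] (legendrePoly l) ^ 2)) =
      assocLegendreInner 0 l l := by
    intro i hi
    rw [← step (i + 1) (Finset.mem_range.mp hi), assocLegendreInner]
    simp only [eval_mul, sq, mul_assoc]
  have hzero : (∫ x in (-1 : ℝ)..1, eval x (legendrePoly l ^ 2)) = assocLegendreInner 0 l l := by
    simp [assocLegendreInner, sq]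
  rw [Finset.sum_congr rfl hterm, hzero] at hsum
  simp at hsum
  rw [step m h, eq_div_iff (by positivity)]
  linarith

end Polynomials

section SphereIntegral

open scoped ContDiff

theorem continuous_sphVec : Continuous fun p : ℝ × ℝ => sphVec p.1 p.2 := by
  refine (PiLp.continuous_toLp 2 _).comp (continuous_pi fun i => ?_)
  fin_cases i <;> simp <;> fun_prop

theorem continuous_sphVec_swap : Continuous fun p : ℝ × ℝ => sphVec p.2 p.1 := by
  refine (PiLp.continuous_toLp 2 _).comp (continuous_pi fun i => ?_)
  fin_cases i <;> simp <;> fun_prop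

@[simp] theorem sphVec_zero (θ φ : ℝ) : sphVec θ φ 0 = sin φ * cos θ := rfl
@[simp] theorem sphVec_one (θ φ : ℝ) : sphVec θ φ 1 = sin φ * sin θ := rfl
@[simp] theorem sphVec_two (θ φ : ℝ) : sphVec θ φ 2 = cos φ := rfl

theorem mem_unitSphere_iff {x : R3} :
    x ∈ Metric.sphere (0 : R3) 1 ↔ x 0 ^ 2 + x 1 ^ 2 + x 2 ^ 2 = 1 := by
  simp [EuclideanSpace.norm_eq, Fin.sum_univ_three]

theorem sphVec_mem_sphere (θ φ : ℝ) : sphVec θ φ ∈ Metric.sphere (0 : R3) 1 := by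
  rw [mem_unitSphere_iff, sphVec_zero, sphVec_one, sphVec_two]
  nlinarith [sin_sq_add_cos_sq θ, sin_sq_add_cos_sq φ]

theorem sphVec_add_two_pi (θ φ : ℝ) : sphVec (θ + 2 * π) φ = sphVec θ φ := by
  simp [sphVec]

/-- The integral of `F` over the unit sphere. -/
def sphInt (F : R3 → ℂ) : ℂ :=
  ∫ φ in (0 : ℝ)..π, ∫ θ in (0 : ℝ)..(2 * π), F (sphVec θ φ) * (sin φ : ℂ)

theorem continuous_comp_sphVec {F : R3 → ℂ} (hF : ContinuousOn F (Metric.sphere 0 1)) :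
    Continuous fun p : ℝ × ℝ => F (sphVec p.1 p.2) :=
  hF.comp_continuous continuous_sphVec fun p => sphVec_mem_sphere p.1 p.2

theorem integrableOn_sphVec {F : R3 → ℂ} (hF : ContinuousOn F (Metric.sphere 0 1)) :
    IntegrableOn (fun p : ℝ × ℝ => F (sphVec p.2 p.1) * (sin p.1 : ℂ))
      (Ioc 0 π ×ˢ Ioc 0 (2 * π)) := by
  have hc : Continuous fun p : ℝ × ℝ => F (sphVec p.2 p.1) * (sin p.1 : ℂ) :=
    ((continuous_comp_sphVec hF).comp continuous_swap).mul (by fun_prop)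
  exact (hc.continuousOn.integrableOn_compact (isCompact_Icc.prod isCompact_Icc)).mono_set
    (prod_mono Ioc_subset_Icc_self Ioc_subset_Icc_self)

theorem sphInt_eq_setIntegral {F : R3 → ℂ} (hF : ContinuousOn F (Metric.sphere 0 1)) :
    sphInt F = ∫ p in (Ioc (0 : ℝ) π ×ˢ Ioc (0 : ℝ) (2 * π)),
      F (sphVec p.2 p.1) * (sin p.1 : ℂ) := by
  rw [Measure.volume_eq_prod, setIntegral_prod _ (integrableOn_sphVec hF), sphInt,
    intervalIntegral.integral_of_le pi_pos.le]
  simp_rw [intervalIntegral.integral_of_le two_pi_pos.le]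

theorem norm_sphInt_le {F : R3 → ℂ} (hF : ContinuousOn F (Metric.sphere 0 1)) {M : ℝ}
    (hM : ∀ x ∈ Metric.sphere (0 : R3) 1, ‖F x‖ ≤ M) : ‖sphInt F‖ ≤ M * (π * (2 * π)) := by
  rw [sphInt_eq_setIntegral hF]
  have hv : volume (Ioc (0 : ℝ) π ×ˢ Ioc (0 : ℝ) (2 * π)) = ENNReal.ofReal (π * (2 * π)) := by
    rw [Measure.volume_eq_prod, Measure.prod_prod, Real.volume_Ioc, Real.volume_Ioc, sub_zero,
      sub_zero, ENNReal.ofReal_mul pi_pos.le]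
  have h := norm_setIntegral_le_of_norm_le_const (μ := volume)
    (s := Ioc (0 : ℝ) π ×ˢ Ioc (0 : ℝ) (2 * π))
    (f := fun p : ℝ × ℝ => F (sphVec p.2 p.1) * (sin p.1 : ℂ)) (C := M)
    (by rw [hv]; exact ENNReal.ofReal_lt_top) (fun p _ => by
      rw [norm_mul, Complex.norm_real, Real.norm_eq_abs]
      have h1 := hM _ (sphVec_mem_sphere p.2 p.1)
      have h2 := abs_sin_le_one p.1
      nlinarith [norm_nonneg (F (sphVec p.2 p.1)), abs_nonneg (sin p.1)])
  rwa [Measure.real, hv, ENNReal.toReal_ofReal (by positivity)] at h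

theorem sphInt_add {F G : R3 → ℂ} (hF : ContinuousOn F (Metric.sphere 0 1))
    (hG : ContinuousOn G (Metric.sphere 0 1)) :
    sphInt (fun x => F x + G x) = sphInt F + sphInt G := by
  rw [sphInt_eq_setIntegral (F := fun x => F x + G x) (hF.add hG), sphInt_eq_setIntegral hF, sphInt_eq_setIntegral hG,
    ← integral_add (integrableOn_sphVec hF) (integrableOn_sphVec hG)]
  simp only [add_mul]

theorem sphInt_const_mul (c : ℂ) (F : R3 → ℂ) :
    sphInt (fun x => c * F x) = c * sphInt F := by
  simp only [sphInt, mul_assoc, intervalIntegral.integral_const_mul]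

theorem sphInt_congr {F G : R3 → ℂ} (h : ∀ x ∈ Metric.sphere (0 : R3) 1, F x = G x) :
    sphInt F = sphInt G := by
  simp only [sphInt, h _ (sphVec_mem_sphere _ _)]

theorem hasSum_sphInt {ι : Type*} [Countable ι] {F : ι → R3 → ℂ}
    (hF : ∀ i, ContinuousOn (F i) (Metric.sphere 0 1)) {b : ι → ℝ} (hb : Summable b)
    (hFb : ∀ i, ∀ x ∈ Metric.sphere (0 : R3) 1, ‖F i x‖ ≤ b i) :
    HasSum (fun i => sphInt (F i)) (sphInt fun x => ∑' i, F i x) := by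
  have hc : ContinuousOn (fun x => ∑' i, F i x) (Metric.sphere (0 : R3) 1) :=
    continuousOn_tsum hF hb hFb
  simp only [sphInt_eq_setIntegral hc, sphInt_eq_setIntegral (hF _)]
  have hnorm : ∀ i (p : ℝ × ℝ), ‖F i (sphVec p.2 p.1) * (sin p.1 : ℂ)‖ ≤ b i := fun i p => by
    rw [norm_mul, Complex.norm_real, Real.norm_eq_abs]
    have h1 := hFb i _ (sphVec_mem_sphere p.2 p.1)
    have h2 := abs_sin_le_one p.1
    nlinarith [norm_nonneg (F i (sphVec p.2 p.1)), abs_nonneg (sin p.1)]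
  have hfin : volume (Ioc (0 : ℝ) π ×ˢ Ioc (0 : ℝ) (2 * π)) ≠ ⊤ := by
    rw [Measure.volume_eq_prod, Measure.prod_prod, Real.volume_Ioc, Real.volume_Ioc]
    exact ENNReal.mul_ne_top ENNReal.ofReal_ne_top ENNReal.ofReal_ne_top
  refine hasSum_integral_of_dominated_convergence (fun i _ => b i)
    (fun i => (integrableOn_sphVec (hF i)).aestronglyMeasurable)
    (fun i => Eventually.of_forall fun p => hnorm i p) (Eventually.of_forall fun _ => hb)
    (integrableOn_const hfin) (Eventually.of_forall fun p => ?_)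
  exact (Summable.of_norm_bounded hb fun i => hFb i _ (sphVec_mem_sphere _ _)).hasSum.mul_right _

end SphereIntegral

section LieDerivative

open scoped ContDiff

/-- The derivative of `h` along the vector field `V`. -/
def lieD (V : R3 → R3) (h : R3 → ℂ) (x : R3) : ℂ := fderiv ℝ h x (V x)

/-- The generator of the rotations about a horizontal axis. -/
def rotField (c d : ℝ) (x : R3) : R3 := !₂[c * x 2, d * x 2, -(c * x 0 + d * x 1)]

/-- The generator of the rotations about the vertical axis. -/
def rotFieldZ (x : R3) : R3 := !₂[-x 1, x 0, 0]

theorem contDiff_rotField (c d : ℝ) : ContDiff ℝ ∞ (rotField c d) := by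
  rw [contDiff_euclidean]
  intro i
  fin_cases i <;> simp [rotField] <;> fun_prop

theorem contDiff_rotFieldZ : ContDiff ℝ ∞ rotFieldZ := by
  rw [contDiff_euclidean]
  intro i
  fin_cases i <;> simp [rotFieldZ] <;> fun_prop

theorem ContDiff.lieD {V : R3 → R3} (hV : ContDiff ℝ ∞ V) {h : R3 → ℂ} (hh : ContDiff ℝ ∞ h) :
    ContDiff ℝ ∞ (lieD V h) :=
  (hh.fderiv_right (m := ∞) (by simp)).clm_apply hV

theorem lieD_mul (V : R3 → R3) {f g : R3 → ℂ} (hf : Differentiable ℝ f)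
    (hg : Differentiable ℝ g) (x : R3) :
    lieD V (fun y => f y * g y) x = lieD V f x * g x + f x * lieD V g x := by
  unfold lieD
  rw [fderiv_fun_mul (hf x) (hg x)]
  simp
  ring

theorem hasDerivAt_euclideanSpace {n : Type*} [Fintype n] {f : ℝ → EuclideanSpace ℝ n}
    {f' : EuclideanSpace ℝ n} {t : ℝ} (h : ∀ i, HasDerivAt (fun s => f s i) (f' i) t) :
    HasDerivAt f f' t := by
  exact (PiLp.continuousLinearEquiv 2 ℝ fun _ : n => ℝ).symm.hasFDerivAt.comp_hasDerivAt t
    (hasDerivAt_pi.2 h)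

theorem hasDerivAt_sphVec_left (θ φ : ℝ) :
    HasDerivAt (fun t => sphVec t φ) (rotFieldZ (sphVec θ φ)) θ := by
  refine hasDerivAt_euclideanSpace fun i => ?_
  fin_cases i
  · simpa [rotFieldZ] using (hasDerivAt_cos θ).const_mul (sin φ)
  · simpa [rotFieldZ] using (hasDerivAt_sin θ).const_mul (sin φ)
  · simpa [rotFieldZ] using hasDerivAt_const θ (cos φ)

theorem hasDerivAt_sphVec_right (θ φ : ℝ) :
    HasDerivAt (fun t => sphVec θ t)
      (!₂[cos φ * cos θ, cos φ * sin θ, -sin φ] : R3) φ := by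
  refine hasDerivAt_euclideanSpace fun i => ?_
  fin_cases i
  · simpa using (hasDerivAt_sin φ).mul_const (cos θ)
  · simpa using (hasDerivAt_sin φ).mul_const (sin θ)
  · simpa using hasDerivAt_cos φ

theorem hasDerivAt_comp_sphVec_left {h : R3 → ℂ} (hh : Differentiable ℝ h) (θ φ : ℝ) :
    HasDerivAt (fun t => h (sphVec t φ)) (lieD rotFieldZ h (sphVec θ φ)) θ :=
  (hh (sphVec θ φ)).hasFDerivAt.comp_hasDerivAt θ (hasDerivAt_sphVec_left θ φ)

theorem continuous_sphVec_left (φ : ℝ) : Continuous fun θ => sphVec θ φ :=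
  continuous_iff_continuousAt.mpr fun θ => (hasDerivAt_sphVec_left θ φ).continuousAt

theorem integral_lieD_rotFieldZ_mul {h : R3 → ℂ} (hh : ContDiff ℝ ∞ h) {u : ℝ → ℂ} {u' : ℝ → ℂ}
    (hu : ∀ t, HasDerivAt u (u' t) t) (hu' : Continuous u') (hper : u (2 * π) = u 0) (φ : ℝ) :
    ∫ θ in (0 : ℝ)..(2 * π), (lieD rotFieldZ h (sphVec θ φ) * u θ + h (sphVec θ φ) * u' θ) = 0 := by
  have hd : ∀ θ, HasDerivAt (fun t => h (sphVec t φ) * u t)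
      (lieD rotFieldZ h (sphVec θ φ) * u θ + h (sphVec θ φ) * u' θ) θ := fun θ =>
    (hasDerivAt_comp_sphVec_left (hh.differentiable (by simp)) θ φ).mul (hu θ)
  have hcu : Continuous u := continuous_iff_continuousAt.mpr fun t => (hu t).continuousAt
  have hcs := continuous_sphVec_left φ
  have hc : Continuous fun θ =>
      lieD rotFieldZ h (sphVec θ φ) * u θ + h (sphVec θ φ) * u' θ :=
    (((contDiff_rotFieldZ.lieD hh).continuous.comp hcs).mul hcu).add
      ((hh.continuous.comp hcs).mul hu')
  rw [intervalIntegral.integral_eq_sub_of_hasDerivAt (fun θ _ => hd θ)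
    (hc.intervalIntegrable _ _)]
  have := sphVec_add_two_pi 0 φ
  rw [zero_add] at this
  rw [this, hper, sub_self]

theorem sphInt_lieD_rotFieldZ {h : R3 → ℂ} (hh : ContDiff ℝ ∞ h) :
    sphInt (lieD rotFieldZ h) = 0 := by
  unfold sphInt
  have := integral_lieD_rotFieldZ_mul hh (u := fun _ => 1) (u' := fun _ => 0)
    (fun t => hasDerivAt_const t 1) continuous_const rfl
  simp only [mul_one, mul_zero, add_zero] at this
  simp [this, intervalIntegral.integral_mul_const]

theorem hasDerivAt_comp_sphVec_right {h : R3 → ℂ} (hh : Differentiable ℝ h) (θ φ : ℝ) :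
    HasDerivAt (fun t => h (sphVec θ t))
      (fderiv ℝ h (sphVec θ φ) !₂[cos φ * cos θ, cos φ * sin θ, -sin φ]) φ :=
  (hh (sphVec θ φ)).hasFDerivAt.comp_hasDerivAt φ (hasDerivAt_sphVec_right θ φ)

theorem sin_mul_lieD_rotField (c d : ℝ) (h : R3 → ℂ) (θ φ : ℝ) :
    lieD (rotField c d) h (sphVec θ φ) * (sin φ : ℂ) =
      (c * cos θ + d * sin θ : ℝ) *
        fderiv ℝ h (sphVec θ φ) !₂[cos φ * cos θ, cos φ * sin θ, -sin φ] * sin φ +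
      (-c * sin θ + d * cos θ : ℝ) * lieD rotFieldZ h (sphVec θ φ) * cos φ := by
  have hvec : sin φ • rotField c d (sphVec θ φ) =
      ((c * cos θ + d * sin θ) * sin φ) • !₂[cos φ * cos θ, cos φ * sin θ, -sin φ] +
        ((-c * sin θ + d * cos θ) * cos φ) • rotFieldZ (sphVec θ φ) := by
    ext i
    fin_cases i <;> simp [rotField, rotFieldZ]
    · linear_combination (-c * sin φ * cos φ) * sin_sq_add_cos_sq θ
    · linear_combination (-d * sin φ * cos φ) * sin_sq_add_cos_sq θ
    · ring
  have h1 := congrArg (fderiv ℝ h (sphVec θ φ)) hvec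
  rw [map_add, map_smul, map_smul, map_smul] at h1
  simp only [Complex.real_smul, Complex.ofReal_mul] at h1
  simp only [lieD]
  linear_combination h1

theorem sphInt_lieD_rotField (c d : ℝ) {h : R3 → ℂ} (hh : ContDiff ℝ ∞ h) :
    sphInt (lieD (rotField c d) h) = 0 := by
  obtain ⟨a, ha⟩ : ∃ a : ℝ → ℝ, ∀ t, a t = c * cos t + d * sin t := ⟨_, fun _ => rfl⟩
  obtain ⟨a', ha'⟩ : ∃ a : ℝ → ℝ, ∀ t, a t = -c * sin t + d * cos t := ⟨_, fun _ => rfl⟩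
  obtain ⟨D, hD⟩ : ∃ D : ℝ → ℝ → ℂ, ∀ φ θ, D φ θ =
    fderiv ℝ h (sphVec θ φ) !₂[cos φ * cos θ, cos φ * sin θ, -sin φ] := ⟨_, fun _ _ => rfl⟩
  obtain ⟨G, hG⟩ : ∃ G : ℝ → ℝ → ℂ, ∀ φ θ, G φ θ =
    a θ * (D φ θ * sin φ + h (sphVec θ φ) * cos φ) := ⟨_, fun _ _ => rfl⟩
  have hda' : ∀ t, HasDerivAt (fun t => (a' t : ℂ)) ((-a t : ℝ) : ℂ) t := fun t => by
    have h1 := ((hasDerivAt_sin t).const_mul (-c)).add ((hasDerivAt_cos t).const_mul d)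
    rw [ha, show -(c * cos t + d * sin t) = -c * cos t + d * -sin t by ring]
    simp only [ha']
    exact h1.ofReal_comp
  have hca : Continuous a := by rw [funext ha]; fun_prop
  have hca' : Continuous a' := by rw [funext ha']; fun_prop
  have hsplit : ∀ θ φ, lieD (rotField c d) h (sphVec θ φ) * (sin φ : ℂ) =
      G φ θ + cos φ * (lieD rotFieldZ h (sphVec θ φ) * a' θ +
        h (sphVec θ φ) * (-a θ : ℝ)) := by
    intro θ φ
    rw [sin_mul_lieD_rotField, ← ha, ← ha', hG, hD, Complex.ofReal_neg]
    ring
  have hvc : Continuous fun p : ℝ × ℝ =>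
      (!₂[cos p.1 * cos p.2, cos p.1 * sin p.2, -sin p.1] : R3) := by
    refine (PiLp.continuous_toLp 2 _).comp (continuous_pi fun i => ?_)
    fin_cases i <;> simp <;> fun_prop
  have hhc : Continuous fun p : ℝ × ℝ => h (sphVec p.2 p.1) :=
    hh.continuous.comp continuous_sphVec_swap
  have hDc : Continuous (Function.uncurry D) := by
    simp only [Function.uncurry_def, hD]
    exact ((hh.continuous_fderiv (by simp)).comp continuous_sphVec_swap).clm_apply hvc
  have hGc : Continuous (Function.uncurry G) := by
    simp only [Function.uncurry_def, hG] at hDc ⊢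
    exact (Complex.continuous_ofReal.comp (hca.comp continuous_snd)).mul
      ((hDc.mul (by fun_prop)).add (hhc.mul (by fun_prop)))
  have hGz : ∫ φ in (0 : ℝ)..π, ∫ θ in (0 : ℝ)..(2 * π), G φ θ = 0 := by
    rw [intervalIntegral_intervalIntegral_swap]
    · have : ∀ θ, ∫ φ in (0 : ℝ)..π, G φ θ = 0 := by
        intro θ
        have hd : ∀ φ, HasDerivAt (fun t => a θ * (h (sphVec θ t) * (sin t : ℂ))) (G φ θ) φ := by
          intro φ
          rw [hG, hD]
          exact ((hasDerivAt_comp_sphVec_right (hh.differentiable (by simp)) θ φ).mul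
            (hasDerivAt_sin φ).ofReal_comp).const_mul _
        rw [intervalIntegral.integral_eq_sub_of_hasDerivAt (fun φ _ => hd φ)
          ((hGc.uncurry_right θ).intervalIntegrable _ _)]
        simp
      simp [this]
    · exact (hGc.continuousOn.integrableOn_compact
        (isCompact_uIcc.prod isCompact_uIcc)).mono_set
        (prod_mono uIoc_subset_uIcc uIoc_subset_uIcc)
  unfold sphInt
  simp only [hsplit]
  rw [← hGz]
  congr 1 with φ
  have hcs := continuous_sphVec_left φ
  have hc : Continuous fun θ =>
      lieD rotFieldZ h (sphVec θ φ) * (a' θ : ℂ) + h (sphVec θ φ) * ((-a θ : ℝ) : ℂ) :=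
    (((contDiff_rotFieldZ.lieD hh).continuous.comp hcs).mul
      (Complex.continuous_ofReal.comp hca')).add
      ((hh.continuous.comp hcs).mul (Complex.continuous_ofReal.comp hca.neg))
  have hc2 : Continuous fun θ => (cos φ : ℂ) *
      (lieD rotFieldZ h (sphVec θ φ) * (a' θ : ℂ) + h (sphVec θ φ) * ((-a θ : ℝ) : ℂ)) :=
    continuous_const.mul hc
  rw [intervalIntegral.integral_add ((hGc.uncurry_left φ).intervalIntegrable _ _)
    (hc2.intervalIntegrable _ _), intervalIntegral.integral_const_mul,
    integral_lieD_rotFieldZ_mul hh hda' (Complex.continuous_ofReal.comp hca.neg) (by simp [ha']),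
    mul_zero, add_zero]

theorem sphInt_lieD_mul {V : R3 → R3} (hV : ContDiff ℝ ∞ V)
    (hint : ∀ h : R3 → ℂ, ContDiff ℝ ∞ h → sphInt (lieD V h) = 0) {f g : R3 → ℂ}
    (hf : ContDiff ℝ ∞ f) (hg : ContDiff ℝ ∞ g) :
    sphInt (fun x => lieD V (lieD V f) x * g x) = sphInt (fun x => f x * lieD V (lieD V g) x) := by
  have key : ∀ f g : R3 → ℂ, ContDiff ℝ ∞ f → ContDiff ℝ ∞ g →
      sphInt (fun x => lieD V f x * g x) = -sphInt (fun x => f x * lieD V g x) := by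
    intro f g hf hg
    have h := hint _ (hf.mul hg)
    rw [sphInt_congr fun x _ =>
      lieD_mul V (hf.differentiable (by simp)) (hg.differentiable (by simp)) x, sphInt_add] at h
    · exact eq_neg_of_add_eq_zero_left h
    · exact ((hV.lieD hf).continuous.mul hg.continuous).continuousOn
    · exact (hf.continuous.mul (hV.lieD hg).continuous).continuousOn
  rw [key _ _ (hV.lieD hf) hg, key _ _ hf (hV.lieD hg), neg_neg]

/-- The operator `1 - Δ` on the unit sphere, acting on functions on the ambient space. -/
def oneSubLap (f : R3 → ℂ) (x : R3) : ℂ :=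
  f x - (lieD (rotField 1 0) (lieD (rotField 1 0) f) x +
    lieD (rotField 0 (-1)) (lieD (rotField 0 (-1)) f) x +
    lieD rotFieldZ (lieD rotFieldZ f) x)

theorem ContDiff.oneSubLap {f : R3 → ℂ} (hf : ContDiff ℝ ∞ f) : ContDiff ℝ ∞ (oneSubLap f) :=
  hf.sub ((((contDiff_rotField _ _).lieD ((contDiff_rotField _ _).lieD hf)).add
    ((contDiff_rotField _ _).lieD ((contDiff_rotField _ _).lieD hf))).add
    (contDiff_rotFieldZ.lieD (contDiff_rotFieldZ.lieD hf)))

theorem sphInt_oneSubLap_mul {f g : R3 → ℂ} (hf : ContDiff ℝ ∞ f) (hg : ContDiff ℝ ∞ g) :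
    sphInt (fun x => oneSubLap f x * g x) = sphInt (fun x => f x * oneSubLap g x) := by
  have expand : ∀ a b : R3 → ℂ, ContDiff ℝ ∞ a → ContDiff ℝ ∞ b →
      sphInt (fun x => a x * oneSubLap b x) = sphInt (fun x => a x * b x) + (-1) * (
        sphInt (fun x => a x * lieD (rotField 1 0) (lieD (rotField 1 0) b) x) +
        sphInt (fun x => a x * lieD (rotField 0 (-1)) (lieD (rotField 0 (-1)) b) x) +
        sphInt (fun x => a x * lieD rotFieldZ (lieD rotFieldZ b) x)) := by
    intro a b ha hb
    have h1 := ((contDiff_rotField 1 0).lieD ((contDiff_rotField 1 0).lieD hb)).continuous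
    have h2 := ((contDiff_rotField 0 (-1)).lieD ((contDiff_rotField 0 (-1)).lieD hb)).continuous
    have h3 := (contDiff_rotFieldZ.lieD (contDiff_rotFieldZ.lieD hb)).continuous
    have ha := ha.continuous
    have hb := hb.continuous
    have e1 := sphInt_add (ha.mul h1).continuousOn (ha.mul h2).continuousOn
    have e2 := sphInt_add ((ha.mul h1).add (ha.mul h2)).continuousOn (ha.mul h3).continuousOn
    have e3 := sphInt_add (ha.mul hb).continuousOn ((continuous_const (y := (-1 : ℂ))).mul
      (((ha.mul h1).add (ha.mul h2)).add (ha.mul h3))).continuousOn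
    have e4 := sphInt_const_mul (-1) (fun x => a x * lieD (rotField 1 0) (lieD (rotField 1 0) b) x +
      a x * lieD (rotField 0 (-1)) (lieD (rotField 0 (-1)) b) x +
      a x * lieD rotFieldZ (lieD rotFieldZ b) x)
    simp only [Pi.mul_def, Pi.add_def] at e1 e2 e3
    rw [← e1, ← e2, ← e4, ← e3]
    congr 1 with x
    simp only [oneSubLap]
    ring
  simp only [mul_comm (oneSubLap f _)]
  rw [expand _ _ hf hg, expand _ _ hg hf]
  simp only [mul_comm (g _)]
  rw [sphInt_lieD_mul (contDiff_rotField _ _) (fun h hh => sphInt_lieD_rotField _ _ hh) hf hg,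
    sphInt_lieD_mul (contDiff_rotField _ _) (fun h hh => sphInt_lieD_rotField _ _ hh) hf hg,
    sphInt_lieD_mul contDiff_rotFieldZ (fun h hh => sphInt_lieD_rotFieldZ hh) hf hg]

end LieDerivative

section SolidMonomial

open scoped ContDiff
open Polynomial

/-- The function `(x₀ + i s x₁) ^ j * q(x₂)`. -/
def solidMono (s : ℝ) (j : ℕ) (q : ℝ[X]) (x : R3) : ℂ :=
  ((x 0 : ℂ) + s * Complex.I * x 1) ^ j * ((q.eval (x 2) : ℝ) : ℂ)

theorem contDiff_solidMono (s : ℝ) (j : ℕ) (q : ℝ[X]) : ContDiff ℝ ∞ (solidMono s j q) := by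
  have hq : ContDiff ℝ ∞ fun x : R3 => q.eval (x 2) :=
    q.contDiff_aeval (𝕜 := ℝ) ∞ |>.comp (by fun_prop)
  have h0 : ∀ i : Fin 3, ContDiff ℝ ∞ fun x : R3 => (x i : ℂ) := fun i =>
    Complex.ofRealCLM.contDiff.comp (by fun_prop)
  exact (((h0 0).add (contDiff_const.mul (h0 1))).pow j).mul (Complex.ofRealCLM.contDiff.comp hq)

theorem conj_solidMono (s : ℝ) (j : ℕ) (q : ℝ[X]) (x : R3) :
    starRingEnd ℂ (solidMono s j q x) = solidMono (-s) j q x := by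
  simp [solidMono]

theorem lieD_eq_of_hasDerivAt {V : R3 → R3} {h : R3 → ℂ} (hh : Differentiable ℝ h) {x : R3}
    {d : ℂ} (hd : HasDerivAt (fun t : ℝ => h (x + t • V x)) d 0) : lieD V h x = d := by
  have h1 : HasDerivAt (fun t : ℝ => x + t • V x) (V x) 0 := by
    simpa using ((hasDerivAt_id (0 : ℝ)).smul_const (V x)).const_add x
  have h2 := (hh (x + (0 : ℝ) • V x)).hasFDerivAt.comp_hasDerivAt (0 : ℝ) h1
  rw [zero_smul, add_zero] at h2
  exact h2.unique hd

theorem hasDerivAt_horizontal_pow (s : ℝ) (j : ℕ) (x v : R3) :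
    HasDerivAt (fun t : ℝ => (((x + t • v) 0 : ℝ) + s * Complex.I * ((x + t • v) 1 : ℝ) : ℂ) ^ j)
      (j * ((x 0 : ℂ) + s * Complex.I * x 1) ^ (j - 1) * (v 0 + s * Complex.I * v 1)) 0 := by
  have h : ∀ i : Fin 3, HasDerivAt (fun t : ℝ => (((x + t • v) i : ℝ) : ℂ)) (v i) 0 := fun i => by
    have := (((hasDerivAt_id (0 : ℝ)).mul_const (v i)).const_add (x i)).ofReal_comp
    simpa using this
  have := ((h 0).fun_add ((h 1).const_mul (s * Complex.I))).fun_pow j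
  simpa using this

theorem hasDerivAt_eval_vertical (q : ℝ[X]) (x v : R3) :
    HasDerivAt (fun t : ℝ => ((q.eval ((x + t • v) 2) : ℝ) : ℂ))
      ((q.derivative.eval (x 2) : ℝ) * v 2) 0 := by
  have h1 : HasDerivAt (fun t : ℝ => (x + t • v) 2) (v 2) 0 := by
    simpa using ((hasDerivAt_id (0 : ℝ)).mul_const (v 2)).const_add (x 2)
  have h2 := ((q.hasDerivAt ((x + (0 : ℝ) • v) 2)).comp (0 : ℝ) h1).ofReal_comp
  simpa using h2

theorem lieD_solidMono (V : R3 → R3) (s : ℝ) (j : ℕ) (q : ℝ[X]) (x : R3) :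
    lieD V (solidMono s j q) x =
      j * ((x 0 : ℂ) + s * Complex.I * x 1) ^ (j - 1) * (V x 0 + s * Complex.I * V x 1) *
        (q.eval (x 2) : ℝ) +
      ((x 0 : ℂ) + s * Complex.I * x 1) ^ j * ((q.derivative.eval (x 2) : ℝ) * V x 2) := by
  refine lieD_eq_of_hasDerivAt ((contDiff_solidMono s j q).differentiable (by simp)) ?_
  have := (hasDerivAt_horizontal_pow s j x (V x)).fun_mul (hasDerivAt_eval_vertical q x (V x))
  simpa [solidMono] using this

theorem lieD_const_mul (V : R3 → R3) (a : ℂ) {g : R3 → ℂ} (hg : Differentiable ℝ g) (x : R3) :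
    lieD V (fun y => a * g y) x = a * lieD V g x := by
  unfold lieD
  rw [fderiv_const_mul (hg x)]
  simp

theorem lieD_rotFieldZ_solidMono {s : ℝ} (hs : s ^ 2 = 1) (j : ℕ) (q : ℝ[X]) (x : R3) :
    lieD rotFieldZ (solidMono s j q) x = (j * (s * Complex.I)) * solidMono s j q x := by
  have hs' : (s : ℂ) ^ 2 = 1 := by exact_mod_cast hs
  rw [lieD_solidMono, solidMono]
  rcases j with _ | j
  · simp [rotFieldZ]
  · simp only [rotFieldZ, Nat.add_sub_cancel, PiLp.toLp_apply, Matrix.cons_val]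
    push_cast
    rw [pow_succ ((x 0 : ℂ) + s * Complex.I * x 1) j]
    linear_combination (((j : ℂ) + 1) * ((x 0 : ℂ) + s * Complex.I * x 1) ^ j *
      (q.eval (x 2) : ℝ)) * (-(s : ℂ) ^ 2 * x 1 * Complex.I_sq + x 1 * hs')

theorem lieD_lieD_rotFieldZ_solidMono {s : ℝ} (hs : s ^ 2 = 1) (j : ℕ) (q : ℝ[X]) (x : R3) :
    lieD rotFieldZ (lieD rotFieldZ (solidMono s j q)) x = -(j : ℂ) ^ 2 * solidMono s j q x := by
  have hs' : (s : ℂ) ^ 2 = 1 := by exact_mod_cast hs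
  rw [funext (lieD_rotFieldZ_solidMono hs j q),
    lieD_const_mul _ _ ((contDiff_solidMono s j q).differentiable (by simp)),
    lieD_rotFieldZ_solidMono hs]
  linear_combination ((j : ℂ) ^ 2 * solidMono s j q x) * ((s : ℂ) ^ 2 * Complex.I_sq - hs')

theorem lieD_lieD_rotField_solidMono (c d s : ℝ) (j : ℕ) (q : ℝ[X]) (x : R3) :
    lieD (rotField c d) (lieD (rotField c d) (solidMono s j q)) x =
      (j * ((j - 1 : ℕ) * ((x 0 : ℂ) + s * Complex.I * x 1) ^ (j - 1 - 1))) *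
        (c + s * Complex.I * d) ^ 2 * (x 2) ^ 2 * (q.eval (x 2) : ℝ) -
      j * ((x 0 : ℂ) + s * Complex.I * x 1) ^ (j - 1) * ((c + s * Complex.I * d) *
        (c * x 0 + d * x 1)) * ((q.eval (x 2) : ℝ) + 2 * x 2 * (q.derivative.eval (x 2) : ℝ)) +
      ((x 0 : ℂ) + s * Complex.I * x 1) ^ j *
        ((c * x 0 + d * x 1) ^ 2 * (q.derivative.derivative.eval (x 2) : ℝ) -
          (c ^ 2 + d ^ 2) * x 2 * (q.derivative.eval (x 2) : ℝ)) := by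
  refine lieD_eq_of_hasDerivAt
    (((contDiff_rotField c d).lieD (contDiff_solidMono s j q)).differentiable (by simp)) ?_
  obtain ⟨v, hv⟩ : ∃ v, v = rotField c d x := ⟨_, rfl⟩
  have hv0 : v 0 = c * x 2 := by rw [hv]; rfl
  have hv1 : v 1 = d * x 2 := by rw [hv]; rfl
  have hv2 : v 2 = -(c * x 0 + d * x 1) := by rw [hv]; rfl
  have hi : ∀ i : Fin 3, HasDerivAt (fun t : ℝ => (((x + t • v) i : ℝ) : ℂ)) (v i) 0 := fun i => by
    have := (((hasDerivAt_id (0 : ℝ)).mul_const (v i)).const_add (x i)).ofReal_comp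
    simpa using this
  have hA := ((((hasDerivAt_horizontal_pow s (j - 1) x v).const_mul (j : ℂ)).mul
    ((hi 2).const_mul (c + s * Complex.I * d))).mul (hasDerivAt_eval_vertical q x v))
  have hB := ((hasDerivAt_horizontal_pow s j x v).mul
    ((hasDerivAt_eval_vertical q.derivative x v).mul
      (((hi 0).const_mul (c : ℂ)).add ((hi 1).const_mul (d : ℂ)))))
  rw [← hv]
  refine ((hA.sub hB).congr_deriv ?_).congr_of_eventuallyEq (Eventually.of_forall fun t => ?_)
  · simp only [zero_smul, add_zero, hv0, hv1, hv2, Pi.mul_apply, Pi.add_apply]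
    push_cast
    ring
  · simp only [lieD_solidMono, Pi.sub_apply, Pi.mul_apply, Pi.add_apply]
    simp only [rotField, PiLp.toLp_apply, Matrix.cons_val]
    push_cast
    ring

theorem oneSubLap_solidMono {s : ℝ} (hs : s ^ 2 = 1) (j : ℕ) (q : ℝ[X]) (x : R3) :
    oneSubLap (solidMono s j q) x = solidMono s j q x -
      ((x 0 : ℂ) + s * Complex.I * x 1) ^ j *
        (((x 0 ^ 2 + x 1 ^ 2) * q.derivative.derivative.eval (x 2) -
          2 * (j + 1) * (x 2 * q.derivative.eval (x 2)) - j * (j + 1) * q.eval (x 2) : ℝ) : ℂ) := by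
  have hs' : (s : ℂ) ^ 2 = 1 := by exact_mod_cast hs
  have hI : (s : ℂ) ^ 2 * Complex.I ^ 2 = -1 := by rw [hs', Complex.I_sq, one_mul]
  have hj : (j : ℂ) * ((x 0 : ℂ) + s * Complex.I * x 1) ^ (j - 1) *
      ((x 0 : ℂ) + s * Complex.I * x 1) = j * ((x 0 : ℂ) + s * Complex.I * x 1) ^ j := by
    rcases j with _ | j
    · simp
    · rw [Nat.add_sub_cancel, pow_succ, mul_assoc]
  rw [oneSubLap, lieD_lieD_rotFieldZ_solidMono hs, lieD_lieD_rotField_solidMono,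
    lieD_lieD_rotField_solidMono, solidMono]
  push_cast
  linear_combination ((q.eval (x 2) : ℝ) + 2 * x 2 * (q.derivative.eval (x 2) : ℝ) : ℂ) * hj -
    (j * ((j - 1 : ℕ) * ((x 0 : ℂ) + s * Complex.I * x 1) ^ (j - 1 - 1))) *
       (x 2) ^ 2 * (q.eval (x 2) : ℝ) * hI

theorem oneSubLap_solidMono_legendrePoly {s : ℝ} (hs : s ^ 2 = 1) (l j : ℕ) {x : R3}
    (hx : x ∈ Metric.sphere (0 : R3) 1) :
    oneSubLap (solidMono s j (derivative^[j] (legendrePoly l))) x =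
      (1 + l * (l + 1)) * solidMono s j (derivative^[j] (legendrePoly l)) x := by
  rw [mem_unitSphere_iff] at hx
  have h := congrArg (eval (x 2)) (legendrePoly_iterate_ode l j)
  simp only [eval_mul, eval_sub, eval_one, eval_pow, eval_X, eval_C] at h
  rw [oneSubLap_solidMono hs, ← Function.iterate_succ_apply' derivative,
    ← Function.iterate_succ_apply' derivative, show x 0 ^ 2 + x 1 ^ 2 = 1 - x 2 ^ 2 by linarith,
    h, solidMono]
  push_cast
  ring

theorem oneSubLap_const_mul (a : ℂ) {f : R3 → ℂ} (hf : ContDiff ℝ ∞ f) (x : R3) :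
    oneSubLap (fun y => a * f y) x = a * oneSubLap f x := by
  have key : ∀ V, ContDiff ℝ ∞ V →
      lieD V (lieD V fun y => a * f y) x = a * lieD V (lieD V f) x := fun V hV => by
    rw [funext (lieD_const_mul V a (hf.differentiable (by simp))),
      lieD_const_mul V a ((hV.lieD hf).differentiable (by simp))]
  rw [oneSubLap, key _ (contDiff_rotField _ _), key _ (contDiff_rotField _ _),
    key _ contDiff_rotFieldZ, oneSubLap]
  ring

end SolidMonomial

section HarmonicExtension

open scoped ContDiff
open Polynomial

/-- The sign of `m`, with `0` counted as positive. -/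
def azimuthSign (m : ℤ) : ℝ := if 0 ≤ m then 1 else -1

theorem azimuthSign_sq (m : ℤ) : azimuthSign m ^ 2 = 1 := by
  unfold azimuthSign
  split_ifs <;> norm_num

theorem azimuthSign_mul_natAbs (m : ℤ) : azimuthSign m * m.natAbs = m := by
  unfold azimuthSign
  split_ifs with h
  · have : ((m.natAbs : ℤ) : ℝ) = (m : ℝ) := by rw [Int.natAbs_of_nonneg h]
    simpa using this
  · have : ((m.natAbs : ℤ) : ℝ) = ((-m : ℤ) : ℝ) := by rw [Int.ofNat_natAbs_of_nonpos (by omega)]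
    push_cast at this
    simp [this]

/-- The normalization constant of the spherical harmonic of degree `l` and order `m`. -/
def harmConst (l : ℕ) (m : ℤ) : ℝ :=
  azimuthSign m ^ m.natAbs * √((2 * l + 1) / (4 * π) * legendreWeight l m.natAbs)

theorem harmConst_sq (l : ℕ) (m : ℤ) :
    harmConst l m ^ 2 = (2 * l + 1) / (4 * π) * legendreWeight l m.natAbs := by
  have := (legendreWeight_pos l m.natAbs).le
  rw [harmConst, mul_pow, ← pow_mul, mul_comm m.natAbs, pow_mul, azimuthSign_sq, one_pow, one_mul,
    sq_sqrt (by positivity)]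

theorem harmConst_ne_zero (l : ℕ) (m : ℤ) : harmConst l m ≠ 0 := by
  have := legendreWeight_pos l m.natAbs
  refine pow_ne_zero_iff two_ne_zero |>.1 ?_
  rw [harmConst_sq]
  positivity

/-- The smooth extension of the spherical harmonic `Y_l^m` to the ambient space, given by the
same polynomial expression in the coordinates. -/
def harmExt (l : ℕ) (m : ℤ) (x : R3) : ℂ :=
  harmConst l m *
    solidMono (azimuthSign m) m.natAbs (derivative^[m.natAbs] (legendrePoly l)) x

theorem contDiff_harmExt (l : ℕ) (m : ℤ) : ContDiff ℝ ∞ (harmExt l m) :=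
  contDiff_const.mul (contDiff_solidMono _ _ _)

theorem contDiff_conj_harmExt (l : ℕ) (m : ℤ) :
    ContDiff ℝ ∞ fun x => starRingEnd ℂ (harmExt l m x) :=
  Complex.conjCLE.contDiff.comp (contDiff_harmExt l m)

theorem harmExt_eq_zero {l : ℕ} {m : ℤ} (h : l < m.natAbs) (x : R3) : harmExt l m x = 0 := by
  simp [harmExt, solidMono, iterate_derivative_legendrePoly_eq_zero h]

theorem oneSubLap_conj_harmExt (l : ℕ) (m : ℤ) {x : R3} (hx : x ∈ Metric.sphere (0 : R3) 1) :
    oneSubLap (fun y => starRingEnd ℂ (harmExt l m y)) x =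
      (1 + l * (l + 1)) * starRingEnd ℂ (harmExt l m x) := by
  have h : ∀ y, starRingEnd ℂ (harmExt l m y) = harmConst l m *
      solidMono (-azimuthSign m) m.natAbs (derivative^[m.natAbs] (legendrePoly l)) y := fun y => by
    rw [harmExt, map_mul, conj_solidMono, Complex.conj_ofReal]
  rw [funext h, oneSubLap_const_mul _ (contDiff_solidMono _ _ _),
    oneSubLap_solidMono_legendrePoly (by rw [neg_sq, azimuthSign_sq]) _ _ hx, h]
  ring

theorem solidMono_sphVec {s : ℝ} (hs : s ^ 2 = 1) (j : ℕ) (q : ℝ[X]) (θ φ : ℝ) :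
    solidMono s j q (sphVec θ φ) =
      ((sin φ ^ j * q.eval (cos φ) : ℝ) : ℂ) * Complex.exp (Complex.I * (s * j : ℝ) * θ) := by
  have h : (cos θ : ℂ) + s * Complex.I * sin θ = Complex.exp (Complex.I * s * θ) := by
    rw [show Complex.I * s * θ = ((s * θ : ℝ) : ℂ) * Complex.I by push_cast; ring,
      Complex.exp_mul_I, ← Complex.ofReal_cos, ← Complex.ofReal_sin]
    rcases eq_or_eq_neg_of_sq_eq_sq s 1 (by rw [hs, one_pow]) with rfl | rfl
    · simp [mul_comm]
    · simp [mul_comm]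
  rw [solidMono, sphVec_zero, sphVec_one, sphVec_two]
  rw [show ((sin φ * cos θ : ℝ) : ℂ) + s * Complex.I * ((sin φ * sin θ : ℝ) : ℂ) =
    sin φ * Complex.exp (Complex.I * s * θ) by rw [← h]; push_cast; ring, mul_pow,
    ← Complex.exp_nat_mul, show Complex.I * (s * j : ℝ) * θ = j * (Complex.I * s * θ) by
      push_cast; ring]
  push_cast
  ring

/-- The colatitude factor of the spherical harmonic of degree `l` and order `m`. -/
def harmLat (l : ℕ) (m : ℤ) (φ : ℝ) : ℝ :=
  harmConst l m * (sin φ ^ m.natAbs * (derivative^[m.natAbs] (legendrePoly l)).eval (cos φ))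

theorem harmExt_sphVec (l : ℕ) (m : ℤ) (θ φ : ℝ) :
    harmExt l m (sphVec θ φ) = harmLat l m φ * Complex.exp (Complex.I * m * θ) := by
  rw [harmExt, solidMono_sphVec (azimuthSign_sq m), azimuthSign_mul_natAbs, harmLat]
  push_cast
  ring

theorem conj_harmExt_sphVec (l : ℕ) (m : ℤ) (θ φ : ℝ) :
    starRingEnd ℂ (harmExt l m (sphVec θ φ)) =
      harmLat l m φ * Complex.exp (-(Complex.I * m * θ)) := by
  rw [harmExt_sphVec, map_mul, Complex.conj_ofReal, ← Complex.exp_conj]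
  simp

theorem assocP_cos (l j : ℕ) {φ : ℝ} (hφ : 0 ≤ sin φ) :
    assocP l j (cos φ) =
      (-1) ^ j * (sin φ ^ j * (derivative^[j] (legendrePoly l)).eval (cos φ)) := by
  rw [assocP, iteratedDeriv_legendreP, show 1 - cos φ ^ 2 = sin φ ^ 2 by
    linarith [sin_sq_add_cos_sq φ], ← rpow_natCast (sin φ) 2, ← rpow_mul hφ,
    show ((2 : ℕ) : ℝ) * (j / 2) = j by push_cast; ring, rpow_natCast, mul_assoc]

theorem sphHarm_eq_harmExt {l : ℕ} {m : ℤ} (hm : m.natAbs ≤ l) (θ : ℝ) {φ : ℝ}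
    (hφ : 0 ≤ sin φ) : sphHarm l m θ φ = harmExt l m (sphVec θ φ) := by
  rw [sphHarm, harmExt_sphVec, harmLat]
  congr 2
  have h3 : ∀ j : ℕ, ((-1 : ℝ) ^ j) * (-1) ^ j = 1 := fun j => by rw [← mul_pow]; simp
  rcases le_or_gt 0 m with h | h
  · lift m to ℕ using h with j
    have h1 : ((l : ℤ) - j).toNat = l - j := by omega
    have h2 : ((l : ℤ) + j).toNat = l + j := by omega
    rw [h1, h2, assocPZ, if_pos (by positivity), Int.toNat_natCast, assocP_cos _ _ hφ, harmConst,
      azimuthSign, if_pos (by positivity), one_pow, one_mul, Int.natAbs_natCast, zpow_natCast,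
      legendreWeight, div_mul_div_comm]
    linear_combination (√((2 * l + 1) * (l - j).factorial / (4 * π * (l + j).factorial)) *
      (sin φ ^ j * (derivative^[j] (legendrePoly l)).eval (cos φ))) * h3 j
  · obtain ⟨j, rfl⟩ : ∃ j : ℕ, m = -j := ⟨m.natAbs, by omega⟩
    have hjl : j ≤ l := by simpa using hm
    have h1 : ((l : ℤ) - -j).toNat = l + j := by omega
    have h2 : ((l : ℤ) + -j).toNat = l - j := by omega
    have hneg : ¬ (0 : ℤ) ≤ -j := by omega
    have hsqrt : √((2 * l + 1) * (l + j).factorial / (4 * π * (l - j).factorial)) *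
        (((l - j).factorial : ℝ) / (l + j).factorial) =
        √((2 * l + 1) / (4 * π) * (((l - j).factorial : ℝ) / (l + j).factorial)) := by
      rw [← sqrt_sq (show (0 : ℝ) ≤ ((l - j).factorial : ℝ) / (l + j).factorial by positivity),
        ← sqrt_mul (by positivity), sqrt_sq (by positivity)]
      congr 1
      have := pi_pos
      have := (l - j).factorial_pos
      have := (l + j).factorial_pos
      field_simp
    rw [h1, h2, assocPZ, if_neg hneg, harmConst, azimuthSign, if_neg hneg, Int.natAbs_neg,
      Int.natAbs_natCast, assocP_cos _ _ hφ, legendreWeight, zpow_neg, zpow_natCast, ← inv_pow,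
      inv_neg_one, ← hsqrt]
    linear_combination ((-1) ^ j *
      √((2 * l + 1) * (l + j).factorial / (4 * π * (l - j).factorial)) *
      (((l - j).factorial : ℝ) / (l + j).factorial) *
      (sin φ ^ j * (derivative^[j] (legendrePoly l)).eval (cos φ))) * h3 j

theorem norm_harmExt_le (l : ℕ) (m : ℤ) {x : R3} (hx : x ∈ Metric.sphere (0 : R3) 1) :
    ‖harmExt l m x‖ ≤ √(2 * l + 1) := by
  rw [mem_unitSphere_iff] at hx
  refine le_sqrt_of_sq_le ?_
  have hw : ‖(x 0 : ℂ) + azimuthSign m * Complex.I * x 1‖ ^ 2 = 1 - x 2 ^ 2 := by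
    rw [← Complex.normSq_eq_norm_sq, Complex.normSq_apply]
    simp
    linear_combination hx + x 1 ^ 2 * azimuthSign_sq m
  have hb := legendreWeight_mul_eval_sq_le l m.natAbs (x := x 2) (by nlinarith)
  rw [harmExt, solidMono, norm_mul, norm_mul, norm_pow, mul_pow, mul_pow, Complex.norm_real,
    Complex.norm_real, norm_eq_abs, norm_eq_abs, sq_abs, sq_abs, ← pow_mul, mul_comm m.natAbs,
    pow_mul, hw, harmConst_sq, mul_assoc]
  calc _ ≤ (2 * l + 1) / (4 * π) * 1 := by gcongr
    _ ≤ 2 * l + 1 := by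
      rw [mul_one]
      exact div_le_self (by positivity) (by linarith [pi_gt_three])

theorem integral_cos_mul_sin {F : ℝ → ℝ} (hF : Continuous F) :
    ∫ φ in (0 : ℝ)..π, F (cos φ) * sin φ = ∫ x in (-1 : ℝ)..1, F x := by
  have h := intervalIntegral.integral_comp_mul_deriv (a := 0) (b := π) (f := cos)
    (f' := fun x => -sin x) (g := F) (fun x _ => hasDerivAt_cos x) (by fun_prop) hF
  rw [cos_zero, cos_pi, intervalIntegral.integral_symm (-1) 1] at h
  simp only [Function.comp_def, mul_neg, intervalIntegral.integral_neg] at h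
  linarith

theorem integral_exp_int_mul (n : ℤ) :
    ∫ θ in (0 : ℝ)..(2 * π), Complex.exp (Complex.I * n * θ) = if n = 0 then 2 * π else 0 := by
  split_ifs with h
  · simp [h]
  · rw [integral_exp_mul_complex (by simp [h])]
    have : Complex.exp (Complex.I * n * ((2 * π : ℝ) : ℂ)) = 1 := by
      rw [Complex.exp_eq_one_iff]
      exact ⟨n, by push_cast; ring⟩
    rw [this]
    simp

theorem sphInt_harmExt_mul_conj {l l' : ℕ} {m m' : ℤ} (hm : m.natAbs ≤ l) :
    sphInt (fun x => harmExt l m x * starRingEnd ℂ (harmExt l' m' x)) =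
      if l = l' ∧ m = m' then 1 else 0 := by
  have hin : ∀ φ, ∫ θ in (0 : ℝ)..(2 * π), harmExt l m (sphVec θ φ) *
      starRingEnd ℂ (harmExt l' m' (sphVec θ φ)) * (sin φ : ℂ) =
      ((harmLat l m φ * harmLat l' m' φ * sin φ : ℝ) : ℂ) *
        if m - m' = 0 then 2 * π else 0 := by
    intro φ
    rw [← integral_exp_int_mul, ← intervalIntegral.integral_const_mul]
    congr 1 with θ
    rw [harmExt_sphVec, conj_harmExt_sphVec, show Complex.I * ((m - m' : ℤ) : ℂ) * θ =
      Complex.I * m * θ + -(Complex.I * m' * θ) by push_cast; ring, Complex.exp_add]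
    push_cast
    ring
  simp only [sphInt, hin]
  by_cases hmm : m = m'
  · subst hmm
    have hlat : ∀ φ, harmLat l m φ * harmLat l' m φ * sin φ = harmConst l m * harmConst l' m *
        (((1 - X ^ 2) ^ m.natAbs * derivative^[m.natAbs] (legendrePoly l) *
          derivative^[m.natAbs] (legendrePoly l')).eval (cos φ) * sin φ) := fun φ => by
      simp only [harmLat, eval_mul, eval_pow, eval_sub, eval_one, eval_X]
      rw [show 1 - cos φ ^ 2 = sin φ ^ 2 by linarith [sin_sq_add_cos_sq φ]]
      ring
    simp only [hlat, sub_self, if_true, and_true]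
    rw [intervalIntegral.integral_mul_const, intervalIntegral.integral_ofReal,
      intervalIntegral.integral_const_mul,
      integral_cos_mul_sin (Polynomial.continuous ((1 - X ^ 2) ^ m.natAbs *
        derivative^[m.natAbs] (legendrePoly l) * derivative^[m.natAbs] (legendrePoly l'))),
      ← assocLegendreInner]
    split_ifs with hl
    · subst hl
      rw [← sq, harmConst_sq, mul_assoc, legendreWeight_mul_assocLegendreInner_self hm]
      norm_cast
      have := pi_pos
      field_simp
      norm_num
    · rw [assocLegendreInner_of_ne _ hl]
      simp
  · simp [sub_ne_zero.2 hmm, hmm]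

end HarmonicExtension

section Completeness

open scoped ContDiff
open Polynomial

theorem eqOn_zero_of_integral_mul_eval_cos_eq_zero {r : ℝ → ℝ} (hr : Continuous r)
    (h : ∀ q : ℝ[X], ∫ φ in (0 : ℝ)..π, r φ * q.eval (cos φ) = 0) : EqOn r 0 (Icc 0 π) := by
  have hrr : Continuous fun φ => r φ * r φ := hr.mul hr
  have hzero : ∫ φ in (0 : ℝ)..π, r φ * r φ ≤ 0 := by
    obtain ⟨K, hK⟩ : ∃ K, K = ∫ φ in (0 : ℝ)..π, |r φ| := ⟨_, rfl⟩
    have hK0 : 0 ≤ K := hK ▸ intervalIntegral.integral_nonneg pi_pos.le fun _ _ => abs_nonneg _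
    refine le_of_forall_pos_le_add fun ε hε => ?_
    rw [zero_add]
    obtain ⟨q, hq⟩ := exists_polynomial_near_of_continuousOn (-1) 1 (fun x => r (arccos x))
      (hr.comp continuous_arccos).continuousOn (ε / (K + 1)) (by positivity)
    have hcq : Continuous fun φ => r φ * q.eval (cos φ) :=
      hr.mul (q.continuous.comp continuous_cos)
    have hsub : ∫ φ in (0 : ℝ)..π, r φ * r φ =
        ∫ φ in (0 : ℝ)..π, (r φ * r φ - r φ * q.eval (cos φ)) := by
      rw [intervalIntegral.integral_sub (hrr.intervalIntegrable _ _)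
        (hcq.intervalIntegrable _ _), h, sub_zero]
    rw [hsub]
    calc _ ≤ ∫ φ in (0 : ℝ)..π, ε / (K + 1) * |r φ| := by
          refine intervalIntegral.integral_mono_on pi_pos.le
            ((hrr.sub hcq).intervalIntegrable _ _)
            ((continuous_const.mul hr.abs).intervalIntegrable _ _) fun φ hφ => ?_
          have h1 := hq (cos φ) ⟨neg_one_le_cos φ, cos_le_one φ⟩
          rw [arccos_cos hφ.1 hφ.2] at h1
          calc r φ * r φ - r φ * q.eval (cos φ) = -(r φ * (q.eval (cos φ) - r φ)) := by ring
            _ ≤ |r φ * (q.eval (cos φ) - r φ)| := neg_le_abs _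
            _ = |q.eval (cos φ) - r φ| * |r φ| := by rw [abs_mul, mul_comm]
            _ ≤ _ := by gcongr
      _ = ε / (K + 1) * K := by rw [intervalIntegral.integral_const_mul, hK]
      _ ≤ ε := by
          rw [div_mul_eq_mul_div, div_le_iff₀ (by positivity)]
          nlinarith
  intro φ hφ
  by_contra hne
  have hpos : 0 < ∫ φ in (0 : ℝ)..π, r φ * r φ :=
    intervalIntegral.integral_pos pi_pos hrr.continuousOn (fun _ _ => mul_self_nonneg _)
      ⟨φ, hφ, mul_self_pos.2 hne⟩
  linarith

theorem eqOn_zero_of_integral_mul_eval_cos_eq_zero_complex {b : ℝ → ℂ} (hb : Continuous b)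
    (h : ∀ q : ℝ[X], ∫ φ in (0 : ℝ)..π, b φ * (q.eval (cos φ) : ℝ) = 0) :
    EqOn b 0 (Icc 0 π) := by
  have hint : ∀ q : ℝ[X], IntervalIntegrable (fun φ => b φ * (q.eval (cos φ) : ℝ)) volume 0 π :=
    fun q => Continuous.intervalIntegrable (hb.mul (Complex.continuous_ofReal.comp
      (q.continuous.comp continuous_cos))) _ _
  have hre := eqOn_zero_of_integral_mul_eval_cos_eq_zero (Complex.continuous_re.comp hb)
    fun q => by
      have := Complex.reCLM.intervalIntegral_comp_comm (hint q)
      rw [h q] at this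
      simpa using this
  have him := eqOn_zero_of_integral_mul_eval_cos_eq_zero (Complex.continuous_im.comp hb)
    fun q => by
      have := Complex.imCLM.intervalIntegral_comp_comm (hint q)
      rw [h q] at this
      simpa using this
  exact fun φ hφ => Complex.ext (hre hφ) (him hφ)

theorem eq_zero_of_integral_mul_exp_eq_zero {v : ℝ → ℂ} (hv : Continuous v)
    (hper : Function.Periodic v (2 * π))
    (h : ∀ m : ℤ, ∫ θ in (0 : ℝ)..(2 * π), v θ * Complex.exp (-(Complex.I * m * θ)) = 0) (θ : ℝ) :
    v θ = 0 := by
  have : Fact (0 < 2 * π) := ⟨two_pi_pos⟩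
  have hc : Continuous (hper.lift : AddCircle (2 * π) → ℂ) :=
    continuous_quot_lift _ hv
  have hcoef : ∀ m : ℤ, fourierCoeff (⟨hper.lift, hc⟩ : C(AddCircle (2 * π), ℂ)) m = 0 := by
    intro m
    rw [fourierCoeff_eq_intervalIntegral _ m 0, zero_add]
    have : ∫ x in (0 : ℝ)..(2 * π), (fourier (-m) (x : AddCircle (2 * π)) : ℂ) •
        (⟨hper.lift, hc⟩ : C(AddCircle (2 * π), ℂ)) x = 0 := by
      rw [← h m]
      congr 1 with x
      rw [fourier_coe_apply, ContinuousMap.coe_mk, Function.Periodic.lift_coe, smul_eq_mul,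
        mul_comm]
      congr 2
      have : (π : ℂ) ≠ 0 := by exact_mod_cast pi_ne_zero
      push_cast
      field_simp
    rw [this, smul_zero]
  have hs := has_pointwise_sum_fourier_series_of_summable
    (f := (⟨hper.lift, hc⟩ : C(AddCircle (2 * π), ℂ)))
    (by rw [funext hcoef]; exact summable_zero) (θ : AddCircle (2 * π))
  simp only [hcoef, zero_smul] at hs
  have := hs.unique hasSum_zero
  rwa [ContinuousMap.coe_mk, Function.Periodic.lift_coe] at this

/-- The Fourier coefficient of order `m` of `u` along the circle of colatitude `φ`. -/
def azimuthCoef (u : R3 → ℂ) (m : ℤ) (φ : ℝ) : ℂ :=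
  ∫ θ in (0 : ℝ)..(2 * π), u (sphVec θ φ) * Complex.exp (-(Complex.I * m * θ))

theorem continuous_azimuthCoef {u : R3 → ℂ} (hu : ContinuousOn u (Metric.sphere 0 1)) (m : ℤ) :
    Continuous (azimuthCoef u m) := by
  have huc : Continuous fun p : ℝ × ℝ => u (sphVec p.2 p.1) :=
    hu.comp_continuous continuous_sphVec_swap fun _ => sphVec_mem_sphere _ _
  have hc : Continuous (Function.uncurry fun φ θ : ℝ =>
      u (sphVec θ φ) * Complex.exp (-(Complex.I * m * θ))) := by
    simp only [Function.uncurry_def]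
    exact huc.mul (by fun_prop)
  exact intervalIntegral.continuous_parametric_intervalIntegral_of_continuous' hc 0 (2 * π)

theorem sphInt_mul_conj_harmExt (u : R3 → ℂ) (l : ℕ) (m : ℤ) :
    sphInt (fun x => u x * starRingEnd ℂ (harmExt l m x)) =
      harmConst l m * ∫ φ in (0 : ℝ)..π, azimuthCoef u m φ * (sin φ ^ (m.natAbs + 1) : ℝ) *
        ((derivative^[m.natAbs] (legendrePoly l)).eval (cos φ) : ℝ) := by
  rw [sphInt, ← intervalIntegral.integral_const_mul]
  congr 1 with φ
  rw [azimuthCoef, ← intervalIntegral.integral_mul_const, ← intervalIntegral.integral_mul_const,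
    ← intervalIntegral.integral_const_mul]
  congr 1 with θ
  rw [conj_harmExt_sphVec, harmLat]
  push_cast
  ring

theorem integral_mul_eval_cos_eq_zero_of_span {b : ℝ → ℂ} (hb : Continuous b) {S : Set ℝ[X]}
    (hS : Submodule.span ℝ S = ⊤)
    (h : ∀ q ∈ S, ∫ φ in (0 : ℝ)..π, b φ * (q.eval (cos φ) : ℝ) = 0) (q : ℝ[X]) :
    ∫ φ in (0 : ℝ)..π, b φ * (q.eval (cos φ) : ℝ) = 0 := by
  have hint : ∀ q : ℝ[X], IntervalIntegrable (fun φ => b φ * (q.eval (cos φ) : ℝ)) volume 0 π :=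
    fun q => Continuous.intervalIntegrable (hb.mul (Complex.continuous_ofReal.comp
      (q.continuous.comp continuous_cos))) _ _
  have hq : q ∈ Submodule.span ℝ S := hS ▸ Submodule.mem_top
  induction hq using Submodule.span_induction with
  | mem q hq => exact h q hq
  | zero => simp
  | add p q _ _ hp hq =>
    simp only [eval_add, Complex.ofReal_add, mul_add]
    rw [intervalIntegral.integral_add (hint p) (hint q), hp, hq, add_zero]
  | smul c q _ hq =>
    simp only [eval_smul, smul_eq_mul, Complex.ofReal_mul, mul_left_comm _ (c : ℂ)]
    rw [intervalIntegral.integral_const_mul, hq, mul_zero]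

theorem eqOn_zero_azimuthCoef {u : R3 → ℂ} (hu : ContinuousOn u (Metric.sphere 0 1))
    (h : ∀ (l : ℕ) (m : ℤ), m.natAbs ≤ l →
      sphInt (fun x => u x * starRingEnd ℂ (harmExt l m x)) = 0) (m : ℤ) :
    EqOn (azimuthCoef u m) 0 (Icc 0 π) := by
  have hac := continuous_azimuthCoef hu m
  have hb : Continuous fun φ => azimuthCoef u m φ * (sin φ ^ (m.natAbs + 1) : ℝ) :=
    hac.mul (by fun_prop)
  have hz := eqOn_zero_of_integral_mul_eval_cos_eq_zero_complex hb
    (integral_mul_eval_cos_eq_zero_of_span hb (span_iterate_derivative_legendrePoly m.natAbs) (by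
      rintro _ ⟨i, rfl⟩
      have hi := h (m.natAbs + i) m (by omega)
      rw [sphInt_mul_conj_harmExt] at hi
      exact (mul_eq_zero.1 hi).resolve_left (by exact_mod_cast harmConst_ne_zero _ _)))
  have hIoo : EqOn (azimuthCoef u m) 0 (Ioo 0 π) := fun φ hφ =>
    (mul_eq_zero.1 (hz (Ioo_subset_Icc_self hφ))).resolve_right
      (by exact_mod_cast pow_ne_zero _ (sin_pos_of_mem_Ioo hφ).ne')
  have := hIoo.closure hac continuous_zero
  rwa [closure_Ioo pi_pos.ne] at this

theorem eq_zero_of_sphInt_mul_conj_harmExt_eq_zero {u : R3 → ℂ}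
    (hu : ContinuousOn u (Metric.sphere 0 1))
    (h : ∀ (l : ℕ) (m : ℤ), m.natAbs ≤ l →
      sphInt (fun x => u x * starRingEnd ℂ (harmExt l m x)) = 0) (θ : ℝ) {φ : ℝ}
    (hφ : φ ∈ Icc 0 π) : u (sphVec θ φ) = 0 :=
  eq_zero_of_integral_mul_exp_eq_zero (v := fun t => u (sphVec t φ))
    (hu.comp_continuous (continuous_sphVec_left φ) fun _ => sphVec_mem_sphere _ _)
    (fun t => by simp only [sphVec_add_two_pi]) (fun m => eqOn_zero_azimuthCoef hu h m hφ) θ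

end Completeness

section Expansion

open scoped ContDiff

/-- The coefficient of `g` with respect to the spherical harmonic `Y_l^m`. -/
def harmProj (g : R3 → ℂ) (l : ℕ) (m : ℤ) : ℂ :=
  sphInt fun x => g x * starRingEnd ℂ (harmExt l m x)

theorem continuousOn_mul_conj_harmExt {g : R3 → ℂ} (hg : ContinuousOn g (Metric.sphere 0 1))
    (l : ℕ) (m : ℤ) :
    ContinuousOn (fun x => g x * starRingEnd ℂ (harmExt l m x)) (Metric.sphere 0 1) :=
  hg.mul (contDiff_conj_harmExt l m).continuous.continuousOn

theorem harmProj_oneSubLap {g : R3 → ℂ} (hg : ContDiff ℝ ∞ g) (l : ℕ) (m : ℤ) :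
    harmProj (oneSubLap g) l m = (1 + l * (l + 1)) * harmProj g l m := by
  rw [harmProj, sphInt_oneSubLap_mul hg (contDiff_conj_harmExt l m), harmProj, ← sphInt_const_mul]
  refine sphInt_congr fun x hx => ?_
  rw [oneSubLap_conj_harmExt l m hx]
  ring

theorem exists_norm_harmProj_le {g : R3 → ℂ} (hg : Continuous g) :
    ∃ K, 0 ≤ K ∧ ∀ l m, ‖harmProj g l m‖ ≤ K * √(2 * l + 1) := by
  obtain ⟨M, hM⟩ := (isCompact_sphere (0 : R3) 1).exists_bound_of_continuousOn hg.continuousOn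
  have hM0 : 0 ≤ M := (norm_nonneg _).trans (hM _ (sphVec_mem_sphere 0 0))
  refine ⟨M * (π * (2 * π)), by positivity, fun l m => ?_⟩
  have h := norm_sphInt_le (continuousOn_mul_conj_harmExt hg.continuousOn l m)
    (M := M * √(2 * l + 1)) fun x hx => by
      rw [norm_mul, RCLike.norm_conj]
      exact mul_le_mul (hM x hx) (norm_harmExt_le l m hx) (norm_nonneg _) hM0
  rw [harmProj]
  linarith

theorem exists_pow_mul_norm_harmProj_le {g : R3 → ℂ} (hg : ContDiff ℝ ∞ g) :
    ∃ K, 0 ≤ K ∧ ∀ (l : ℕ) m, (1 + l * (l + 1) : ℝ) ^ 3 * ‖harmProj g l m‖ ≤ K * √(2 * l + 1) := by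
  obtain ⟨K, hK, h⟩ := exists_norm_harmProj_le hg.oneSubLap.oneSubLap.oneSubLap.continuous
  refine ⟨K, hK, fun l m => ?_⟩
  have h1 := h l m
  rw [harmProj_oneSubLap hg.oneSubLap.oneSubLap, harmProj_oneSubLap hg.oneSubLap,
    harmProj_oneSubLap hg] at h1
  have h2 : ‖(1 + l * (l + 1) : ℂ)‖ = 1 + l * (l + 1) := by
    rw [show (1 + l * (l + 1) : ℂ) = ((1 + l * (l + 1) : ℝ) : ℂ) by push_cast; ring,
      Complex.norm_real, norm_of_nonneg (by positivity)]
  simp only [norm_mul, h2] at h1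
  linarith

theorem summable_one_div_one_add_sq : Summable fun n : ℕ => 1 / (1 + (n : ℝ)) ^ 2 := by
  have := (summable_nat_add_iff 1).2 (summable_one_div_nat_pow.2 one_lt_two)
  simpa [add_comm] using this

theorem summable_one_div_one_add_natAbs_sq :
    Summable fun m : ℤ => 1 / (1 + (m.natAbs : ℝ)) ^ 2 := by
  refine Summable.of_nat_of_neg ?_ ?_ <;>
  · simp only [Int.natAbs_neg, Int.natAbs_natCast]
    exact summable_one_div_one_add_sq

theorem summable_one_div_one_add_sq_mul :
    Summable fun p : ℕ × ℤ => 1 / (1 + (p.1 : ℝ)) ^ 2 * (1 / (1 + (p.2.natAbs : ℝ)) ^ 2) :=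
  Summable.mul_of_nonneg (f := fun n : ℕ => 1 / (1 + (n : ℝ)) ^ 2)
    (g := fun m : ℤ => 1 / (1 + (m.natAbs : ℝ)) ^ 2) summable_one_div_one_add_sq
    summable_one_div_one_add_natAbs_sq (fun _ => by positivity) (fun _ => by positivity)

theorem exists_summable_bound_harmProj {g : R3 → ℂ} (hg : ContDiff ℝ ∞ g) :
    ∃ b : ℕ × ℤ → ℝ, Summable b ∧ ∀ p, ∀ x ∈ Metric.sphere (0 : R3) 1,
      ‖harmProj g p.1 p.2 * harmExt p.1 p.2 x‖ ≤ b p := by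
  obtain ⟨K, hK, h⟩ := exists_pow_mul_norm_harmProj_le hg
  refine ⟨fun p => 16 * K * (1 / (1 + (p.1 : ℝ)) ^ 2 * (1 / (1 + (p.2.natAbs : ℝ)) ^ 2)),
    summable_one_div_one_add_sq_mul.mul_left _, fun ⟨l, m⟩ x hx => ?_⟩
  dsimp only
  rcases lt_or_ge l m.natAbs with hlm | hlm
  · rw [harmExt_eq_zero hlm, mul_zero, norm_zero]
    positivity
  · have hlm' : (m.natAbs : ℝ) ≤ l := by exact_mod_cast hlm
    have h1 := h l m
    have h2 := norm_harmExt_le l m hx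
    have hl : (0 : ℝ) ≤ l := l.cast_nonneg
    have hlap : (1 + (l : ℝ)) ^ 2 ≤ 2 * (1 + l * (l + 1)) := by nlinarith
    have hcube : ((1 + (l : ℝ)) ^ 2) ^ 3 ≤ 8 * (1 + l * (l + 1) : ℝ) ^ 3 :=
      calc ((1 + (l : ℝ)) ^ 2) ^ 3 ≤ (2 * (1 + l * (l + 1))) ^ 3 := by gcongr
        _ = _ := by ring
    have hprod : ((1 + (l : ℝ)) ^ 2) ^ 3 * ‖harmProj g l m * harmExt l m x‖ ≤
        8 * K * (2 * l + 1) := by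
      rw [norm_mul]
      calc _ ≤ 8 * (1 + l * (l + 1) : ℝ) ^ 3 * (‖harmProj g l m‖ * ‖harmExt l m x‖) := by gcongr
        _ = 8 * (((1 + l * (l + 1) : ℝ) ^ 3 * ‖harmProj g l m‖) * ‖harmExt l m x‖) := by ring
        _ ≤ 8 * ((K * √(2 * l + 1)) * √(2 * l + 1)) := by gcongr
        _ = _ := by rw [mul_assoc K, mul_self_sqrt (by positivity)]; ring
    have hm2 : (1 + (m.natAbs : ℝ)) ^ 2 ≤ (1 + (l : ℝ)) ^ 2 := by gcongr
    calc ‖harmProj g l m * harmExt l m x‖ ≤ 16 * K * (1 / (1 + (l : ℝ)) ^ 2 *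
          (1 / (1 + (l : ℝ)) ^ 2)) := by
          rw [one_div_mul_one_div, mul_one_div, le_div_iff₀ (by positivity)]
          refine le_of_mul_le_mul_left ?_ (show 0 < (1 + (l : ℝ)) ^ 2 by positivity)
          calc _ = ((1 + (l : ℝ)) ^ 2) ^ 3 * ‖harmProj g l m * harmExt l m x‖ := by ring
            _ ≤ 8 * K * (2 * l + 1) := hprod
            _ ≤ 8 * K * (2 * (1 + (l : ℝ)) ^ 2) := by gcongr; nlinarith
            _ = _ := by ring
      _ ≤ _ := by gcongr

theorem harmProj_tsum {c : ℕ × ℤ → ℂ} {b : ℕ × ℤ → ℝ} (hb : Summable b)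
    (hcb : ∀ p, ∀ x ∈ Metric.sphere (0 : R3) 1, ‖c p * harmExt p.1 p.2 x‖ ≤ b p)
    {l : ℕ} {m : ℤ} (hm : m.natAbs ≤ l) :
    harmProj (fun x => ∑' p, c p * harmExt p.1 p.2 x) l m = c (l, m) := by
  have hsum := hasSum_sphInt
    (F := fun p x => c p * harmExt p.1 p.2 x * starRingEnd ℂ (harmExt l m x))
    (fun p => continuousOn_mul_conj_harmExt
      (contDiff_const.mul (contDiff_harmExt p.1 p.2)).continuous.continuousOn l m)
    (hb.mul_right √(2 * l + 1)) fun p x hx => by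
      rw [norm_mul, RCLike.norm_conj]
      exact mul_le_mul (hcb p x hx) (norm_harmExt_le l m hx) (norm_nonneg _)
        ((norm_nonneg _).trans (hcb p x hx))
  have hterm : ∀ p : ℕ × ℤ,
      sphInt (fun x => c p * harmExt p.1 p.2 x * starRingEnd ℂ (harmExt l m x)) =
        if p = (l, m) then c (l, m) else 0 := by
    rintro ⟨l', m'⟩
    rcases lt_or_ge l' m'.natAbs with h | h
    · rw [if_neg (by rintro ⟨⟩; omega)]
      simp [sphInt, harmExt_eq_zero h]
    · simp only [mul_assoc]
      rw [sphInt_const_mul, sphInt_harmExt_mul_conj h]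
      by_cases hp : l' = l ∧ m' = m
      · obtain ⟨rfl, rfl⟩ := hp
        simp
      · rw [if_neg hp, if_neg (by simpa using hp), mul_zero]
  simp only [hterm, tsum_mul_right] at hsum
  exact hsum.unique (hasSum_ite_eq _ _)

/-- The spherical harmonic expansion of a smooth function on the sphere. -/
theorem hasSum_harmProj_mul_harmExt {g : R3 → ℂ} (hg : ContDiff ℝ ∞ g) (θ : ℝ) {φ : ℝ}
    (hφ : φ ∈ Icc 0 π) :
    HasSum (fun p : ℕ × ℤ => harmProj g p.1 p.2 * harmExt p.1 p.2 (sphVec θ φ))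
      (g (sphVec θ φ)) := by
  obtain ⟨b, hb, hgb⟩ := exists_summable_bound_harmProj hg
  have hT : ContinuousOn (fun x => ∑' p : ℕ × ℤ, harmProj g p.1 p.2 * harmExt p.1 p.2 x)
      (Metric.sphere (0 : R3) 1) :=
    continuousOn_tsum
      (fun p => (contDiff_const.mul (contDiff_harmExt p.1 p.2)).continuous.continuousOn) hb hgb
  have hzero := eq_zero_of_sphInt_mul_conj_harmExt_eq_zero
    (u := fun x => g x + (-1) * ∑' p : ℕ × ℤ, harmProj g p.1 p.2 * harmExt p.1 p.2 x)
    (hg.continuous.continuousOn.add (continuousOn_const.mul hT)) (fun l m hm => by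
      have hneg : ContinuousOn (fun x => (-1 : ℂ) *
          ((∑' p : ℕ × ℤ, harmProj g p.1 p.2 * harmExt p.1 p.2 x) *
            starRingEnd ℂ (harmExt l m x))) (Metric.sphere 0 1) :=
        continuousOn_const.mul (continuousOn_mul_conj_harmExt hT l m)
      simp only [add_mul, mul_assoc (-1 : ℂ)]
      rw [sphInt_add (continuousOn_mul_conj_harmExt hg.continuous.continuousOn l m) hneg,
        sphInt_const_mul, ← harmProj, ← harmProj, harmProj_tsum hb hgb hm]
      ring) θ hφ
  have hs : Summable fun p : ℕ × ℤ => harmProj g p.1 p.2 * harmExt p.1 p.2 (sphVec θ φ) :=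
    Summable.of_norm_bounded hb fun p => hgb p _ (sphVec_mem_sphere θ φ)
  convert hs.hasSum using 1
  linear_combination hzero

end Expansion

section Parity

open scoped ContDiff
open Polynomial

theorem legendreP_neg (l : ℕ) (x : ℝ) : legendreP l (-x) = (-1) ^ l * legendreP l x := by
  rw [legendreP, legendreP, ← Finset.sum_range_reflect, mul_left_comm]
  congr 1
  rw [Finset.mul_sum]
  refine Finset.sum_congr rfl fun k hk => ?_
  have hk : k ≤ l := Nat.lt_succ_iff.1 (Finset.mem_range.1 hk)
  rw [show l + 1 - 1 - k = l - k by omega, Nat.choose_symm hk, Nat.sub_sub_self hk,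
    show -x - 1 = -1 * (x + 1) by ring, show -x + 1 = -1 * (x - 1) by ring, mul_pow, mul_pow]
  have : ((-1 : ℝ)) ^ l = (-1) ^ k * (-1) ^ (l - k) := by rw [← pow_add]; congr 1; omega
  rw [this]
  ring

theorem eval_neg_iterate_derivative_legendrePoly (l m : ℕ) (x : ℝ) :
    (derivative^[m] (legendrePoly l)).eval (-x) =
      (-1) ^ (l + m) * (derivative^[m] (legendrePoly l)).eval x := by
  have h := iteratedDeriv_comp_neg m (legendreP l) x
  simp only [legendreP_neg] at h
  rw [iteratedDeriv_const_mul_field, smul_eq_mul, iteratedDeriv_legendreP,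
    iteratedDeriv_legendreP] at h
  have h1 : ((-1 : ℝ) ^ m) * (-1) ^ m = 1 := by rw [← mul_pow]; simp
  rw [pow_add]
  linear_combination -(-1) ^ m * h - (derivative^[m] (legendrePoly l)).eval (-x) * h1

theorem harmExt_neg (l : ℕ) (m : ℤ) (x : R3) : harmExt l m (-x) = (-1) ^ l * harmExt l m x := by
  have h1 : ((-1 : ℂ) ^ m.natAbs) * (-1) ^ m.natAbs = 1 := by rw [← mul_pow]; simp
  simp only [harmExt, solidMono, PiLp.neg_apply]
  rw [eval_neg_iterate_derivative_legendrePoly]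
  push_cast
  rw [show -(x 0 : ℂ) + azimuthSign m * Complex.I * -(x 1 : ℂ) =
    -1 * (x 0 + azimuthSign m * Complex.I * x 1) by ring, mul_pow, pow_add]
  linear_combination (harmConst l m * (x 0 + azimuthSign m * Complex.I * x 1) ^ m.natAbs *
    (-1) ^ l * ((derivative^[m.natAbs] (legendrePoly l)).eval (x 2) : ℝ) : ℂ) * h1

theorem neg_sphVec (θ φ : ℝ) : -sphVec θ φ = sphVec (θ + π) (π - φ) := by
  ext i
  fin_cases i <;> simp

theorem sphInt_comp_neg (F : R3 → ℂ) : sphInt (fun x => F (-x)) = sphInt F := by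
  have hθ : ∀ φ, ∫ θ in (0 : ℝ)..(2 * π), F (-sphVec θ φ) * (sin φ : ℂ) =
      ∫ θ in (0 : ℝ)..(2 * π), F (sphVec θ (π - φ)) * (sin (π - φ) : ℂ) := by
    intro φ
    have hper : Function.Periodic (fun θ => F (sphVec θ (π - φ)) * (sin (π - φ) : ℂ)) (2 * π) :=
      fun θ => by simp only [sphVec_add_two_pi]
    have h := hper.intervalIntegral_add_eq π 0
    have hsub := intervalIntegral.integral_comp_add_right (a := 0) (b := 2 * π)
      (fun θ => F (sphVec θ (π - φ)) * (sin (π - φ) : ℂ)) π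
    rw [zero_add, add_comm (2 * π)] at hsub
    rw [zero_add] at h
    rw [← h, ← hsub]
    simp only [neg_sphVec, sin_pi_sub]
  have hφ := intervalIntegral.integral_comp_sub_left (a := 0) (b := π)
    (fun φ => ∫ θ in (0 : ℝ)..(2 * π), F (sphVec θ φ) * (sin φ : ℂ)) π
  rw [sub_self, sub_zero] at hφ
  simp only [sphInt, hθ]
  exact hφ

theorem harmProj_comp_neg (g : R3 → ℂ) (l : ℕ) (m : ℤ) :
    harmProj (fun x => g (-x)) l m = (-1) ^ l * harmProj g l m := by
  rw [harmProj, harmProj, ← sphInt_comp_neg (fun x => g x * _), ← sphInt_const_mul]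
  congr 1 with x
  have h1 : ((-1 : ℂ) ^ l) * (-1) ^ l = 1 := by rw [← mul_pow]; simp
  rw [harmExt_neg, map_mul, map_pow, map_neg, map_one]
  linear_combination -(g (-x) * starRingEnd ℂ (harmExt l m x)) * h1

theorem harmProj_add_comp_neg {g : R3 → ℂ} (hg : Continuous g) (l : ℕ) (m : ℤ) :
    harmProj (fun x => g x + g (-x)) l m = (1 + (-1) ^ l) * harmProj g l m := by
  have hg' : Continuous fun x => g (-x) := hg.comp continuous_neg
  rw [one_add_mul, ← harmProj_comp_neg, harmProj, harmProj, harmProj,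
    ← sphInt_add (continuousOn_mul_conj_harmExt hg.continuousOn l m)
      (continuousOn_mul_conj_harmExt hg'.continuousOn l m)]
  simp only [add_mul]

theorem harmCoef_eq_harmProj (f : R3 → ℝ) {l : ℕ} {m : ℤ} (hm : m.natAbs ≤ l) (ρ : ℝ) :
    harmCoef f l m ρ = harmProj (fun x => (f (ρ • x) : ℂ)) l m := by
  refine intervalIntegral.integral_congr fun φ hφ => ?_
  rw [uIcc_of_le pi_pos.le] at hφ
  simp only [sphHarm_eq_harmExt hm _ (sin_nonneg_of_mem_Icc hφ)]

/-- The even-degree part of the spherical harmonic expansion of a smooth function is the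
expansion of its even part. -/
theorem hasSum_even_harmProj_mul_harmExt {g : R3 → ℂ} (hg : ContDiff ℝ ∞ g) (θ : ℝ) {φ : ℝ}
    (hφ : φ ∈ Icc 0 π) :
    HasSum (fun p : ℕ × ℤ => 2 * (harmProj g (2 * p.1) p.2 * harmExt (2 * p.1) p.2 (sphVec θ φ)))
      (g (sphVec θ φ) + g (-sphVec θ φ)) := by
  have hs := hasSum_harmProj_mul_harmExt (g := fun x => g x + g (-x))
    (hg.add (hg.comp contDiff_neg)) θ hφ
  simp only [harmProj_add_comp_neg hg.continuous] at hs
  have hinj : Function.Injective fun p : ℕ × ℤ => (2 * p.1, p.2) := by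
    rintro ⟨k, m⟩ ⟨k', m'⟩ h
    simpa using h
  rw [← hinj.hasSum_iff] at hs
  · convert! hs using 2 with p
    simp only [Function.comp_apply, pow_mul]
    norm_num [mul_assoc]
  · rintro ⟨l, m⟩ hlm
    rcases Nat.even_or_odd' l with ⟨k, rfl | rfl⟩
    · exact absurd ⟨(k, m), rfl⟩ hlm
    · simp [pow_succ, pow_mul]

end Parity

/-- Theorem 3 of the paper: if `f` is smooth, compactly supported in the
open upper half space, then on the upper hemisphere the polar form `F` is recovered from
twice the sum of its even-degree spherical harmonic expansion, the double series (indexed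
by pairs `(k,m)` with `l = 2k`, `|m| ≤ l`) converging absolutely. -/
theorem even_coeffs_determine_upper_half
    (f : R3 → ℝ) (hf : ContDiff ℝ (⊤ : ℕ∞) f) (hfc : HasCompactSupport f)
    (hsupp : tsupport f ⊆ {x : R3 | 0 < x 2})
    (ρ θ φ : ℝ) (hρ : 0 ≤ ρ) (hθ : θ ∈ Icc (0:ℝ) (2 * π)) (hφ : φ ∈ Icc (0:ℝ) (π / 2)) :
    Summable (fun km : ℕ × ℤ =>
      ‖if km.2.natAbs ≤ 2 * km.1 then
          harmCoef f (2 * km.1) km.2 ρ * sphHarm (2 * km.1) km.2 θ φ else 0‖) ∧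
    HasSum (fun km : ℕ × ℤ =>
      (2 : ℂ) * if km.2.natAbs ≤ 2 * km.1 then
          harmCoef f (2 * km.1) km.2 ρ * sphHarm (2 * km.1) km.2 θ φ else 0)
      ((f (ρ • sphVec θ φ) : ℝ) : ℂ) := by
  have hφ' : φ ∈ Icc 0 π := ⟨hφ.1, hφ.2.trans (by linarith [pi_pos])⟩
  have hterm : ∀ km : ℕ × ℤ, (if km.2.natAbs ≤ 2 * km.1 then
      harmCoef f (2 * km.1) km.2 ρ * sphHarm (2 * km.1) km.2 θ φ else 0) =
      harmProj (fun x => (f (ρ • x) : ℂ)) (2 * km.1) km.2 *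
        harmExt (2 * km.1) km.2 (sphVec θ φ) := by
    intro km
    split_ifs with h
    · rw [harmCoef_eq_harmProj f h, sphHarm_eq_harmExt h _ (sin_nonneg_of_mem_Icc hφ')]
    · rw [harmExt_eq_zero (not_le.1 h), mul_zero]
  have hg : ContDiff ℝ (⊤ : ℕ∞) fun x : R3 => (f (ρ • x) : ℂ) :=
    Complex.ofRealCLM.contDiff.comp (hf.comp (contDiff_const_smul ρ))
  have hneg : f (ρ • -sphVec θ φ) = 0 := by
    refine image_eq_zero_of_notMem_tsupport fun h => ?_
    have h2 : 0 < ρ * -cos φ := hsupp h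
    have hcos := cos_nonneg_of_mem_Icc ⟨by linarith [hφ.1, pi_pos], hφ.2⟩
    nlinarith
  have hs := hasSum_even_harmProj_mul_harmExt hg θ hφ'
  simp only [hneg, Complex.ofReal_zero, add_zero] at hs
  simp only [hterm]
  exact ⟨(summable_mul_left_iff two_ne_zero |>.1 hs.summable).norm, hs⟩
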